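/- arXiv:2211.02472 — 4 statements merged into one kernel-verified Lean document; each statement's English description precedes it below -/
import Mathlib

section
/- Suppose a = 1/2, L satisfies Assumptions A1 and A2, π_{2n} satisfies (C3), Assumption 2 holds, p_n ∝ n^{−1} (the extremely sparse case ε = 1), and log(1/α_n) = log n − (1/2) log log n + c_n where c_n → ∞ and c_n = o(log log n). Then the full Bayes decision rule is asymptotically Bayes optimal under sparsity: lim_{n→∞} R^{FB}_{OG} / R^{BO}_{Opt} = 1. -/
open MeasureTheory ProbabilityTheory Real Filter Set

noncomputable section

namespace PaperGL

/-- Posterior density kernel of the shrinkage coefficient `κ` given `(x, τ)`: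
`π(κ | x, τ) ∝ κ^(a-1/2) (1-κ)^(-a-1) L(τ⁻²(κ⁻¹-1)) exp((1-κ)x²/2)` on `(0,1)`. -/
def kdens (a : ℝ) (L : ℝ → ℝ) (x τ κ : ℝ) : ℝ :=
  κ ^ (a - 1/2) * (1 - κ) ^ (-a - 1) * L ((1/τ^2) * (1/κ - 1)) * Real.exp ((1 - κ) * x^2 / 2)

/-- Posterior expectation of `g(κ)` given `(x, τ)`. -/
def kExp (a : ℝ) (L : ℝ → ℝ) (x τ : ℝ) (g : ℝ → ℝ) : ℝ :=
  (∫ κ in Set.Ioo (0:ℝ) 1, g κ * kdens a L x τ κ) /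
    (∫ κ in Set.Ioo (0:ℝ) 1, kdens a L x τ κ)

/-- `E(1−κ | x, τ)`. -/
def E1mK (a : ℝ) (L : ℝ → ℝ) (x τ : ℝ) : ℝ := kExp a L x τ (fun κ => 1 - κ)

/-- Posterior mean `T_τ(x) = x · E(1−κ | x, τ)`. -/
def postMean (a : ℝ) (L : ℝ → ℝ) (τ x : ℝ) : ℝ := x * E1mK a L x τ

/-- Posterior variance `Var(θ | x, τ)` of the mixture over `κ` of `N((1−κ)x, 1−κ)`. -/
def postVar (a : ℝ) (L : ℝ → ℝ) (x τ : ℝ) : ℝ :=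
  E1mK a L x τ + x^2 * (kExp a L x τ (fun κ => (1 - κ)^2) - (E1mK a L x τ)^2)

/-- `E(1−κ | x, τ)` in the `t = τ⁻²(κ⁻¹−1)` parametrisation. -/
def E1mKt (a : ℝ) (L : ℝ → ℝ) (x τ : ℝ) : ℝ :=
  (τ^2 * ∫ t in Set.Ioi (0:ℝ),
      (1 + t*τ^2) ^ (-(3:ℝ)/2) * t ^ (-a) * L t * Real.exp ((x^2/2) * (t*τ^2/(1+t*τ^2)))) /
  (∫ t in Set.Ioi (0:ℝ),
      (1 + t*τ^2) ^ (-(1:ℝ)/2) * t ^ (-a-1) * L t * Real.exp ((x^2/2) * (t*τ^2/(1+t*τ^2))))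

/-- The empirical Bayes estimate `τ̂` of the global shrinkage parameter. -/
def tauHat (c1 c2 : ℝ) (n : ℕ) (x : Fin n → ℝ) : ℝ :=
  max (1/(n:ℝ)) ((1/(c2*n)) * ∑ i, if Real.sqrt (c1 * Real.log n) < |x i| then (1:ℝ) else 0)

/-- Nearly black vectors: `θ ∈ ℓ₀[q]`. -/
def sparse (n q : ℕ) (θ : Fin n → ℝ) : Prop := Nat.card {i : Fin n // θ i ≠ 0} ≤ q

/-- The sampling distribution `N_n(θ₀, I_n)`. -/
def Pmeas (n : ℕ) (θ0 : Fin n → ℝ) : Measure (Fin n → ℝ) :=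
  Measure.pi fun i => gaussianReal (θ0 i) 1

/-- `q_n ∝ n^β` (two-sided proportionality). -/
def propTo (q : ℕ → ℕ) (β : ℝ) : Prop :=
  ∃ k1 k2 : ℝ, 0 < k1 ∧ 0 < k2 ∧
    ∀ᶠ n : ℕ in atTop, k1 * (n:ℝ)^β ≤ (q n : ℝ) ∧ (q n : ℝ) ≤ k2 * (n:ℝ)^β

/-- `p_n ∝ n^(-e)` for a real sequence. -/
def propToR (p : ℕ → ℝ) (β : ℝ) : Prop :=
  ∃ k1 k2 : ℝ, 0 < k1 ∧ 0 < k2 ∧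
    ∀ᶠ n : ℕ in atTop, k1 * (n:ℝ)^β ≤ p n ∧ p n ≤ k2 * (n:ℝ)^β

/-- Assumptions (A1) and (A2) on the slowly varying function `L`, together with
positivity, measurability. -/
def AssumpL (L : ℝ → ℝ) (Mb c0 t0 : ℝ) : Prop :=
  Measurable L ∧ (∀ t, 0 < t → 0 < L t) ∧ (∀ t, 0 < t → L t ≤ Mb) ∧
    0 < c0 ∧ 0 < t0 ∧ ∀ t, t0 ≤ t → c0 ≤ L t

/-- Integrability of `t^(−a−1) L t` on `(0,∞)` with positive integral, and `K` its inverse. -/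
def Kcond (a : ℝ) (L : ℝ → ℝ) (K : ℝ) : Prop :=
  MeasureTheory.IntegrableOn (fun t => t ^ (-a-1) * L t) (Set.Ioi (0:ℝ)) ∧
    0 < ∫ t in Set.Ioi (0:ℝ), t ^ (-a-1) * L t ∧
    K = (∫ t in Set.Ioi (0:ℝ), t ^ (-a-1) * L t)⁻¹

/-- The κ-posterior as a probability measure on `(0,1)`. -/
def kPostMeasure (a : ℝ) (L : ℝ → ℝ) (x τ : ℝ) : Measure ℝ :=
  (∫⁻ κ in Set.Ioo (0:ℝ) 1, ENNReal.ofReal (kdens a L x τ κ))⁻¹ •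
    ((volume.restrict (Set.Ioo (0:ℝ) 1)).withDensity fun κ => ENNReal.ofReal (kdens a L x τ κ))

/-- The posterior distribution of `θ` given `(x, τ)`: mixture over `κ` of `N((1−κ)x, 1−κ)`. -/
def thetaPost (a : ℝ) (L : ℝ → ℝ) (x τ : ℝ) : Measure ℝ :=
  (kPostMeasure a L x τ).bind fun κ => gaussianReal ((1-κ)*x) (Real.toNNReal (1-κ))

/-- `Π_τ(· | X)`: the posterior of the vector `θ` given `(X, τ)`. -/
def PiTau (a : ℝ) (L : ℝ → ℝ) (n : ℕ) (X : Fin n → ℝ) (τ : ℝ) : Measure (Fin n → ℝ) :=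
  Measure.pi fun i => thetaPost a L (X i) τ

/-- Marginal density `m(x, τ)` of one observation given `τ` (mixing over `l = λ²`). -/
def marg (a K : ℝ) (L : ℝ → ℝ) (x τ : ℝ) : ℝ :=
  ∫ l in Set.Ioi (0:ℝ), K * l ^ (-a-1) * L l *
    ((Real.sqrt (2 * Real.pi * (1 + l * τ^2)))⁻¹ * Real.exp (-(x^2) / (2 * (1 + l * τ^2))))

/-- Posterior density of `τ` given `X`, for a prior `π2` supported on `[lo, hi]`. -/
def tauWeight (a K : ℝ) (L : ℝ → ℝ) (π2 : ℝ → ℝ) (lo hi : ℝ) (n : ℕ)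
    (X : Fin n → ℝ) (τ : ℝ) : ℝ :=
  (π2 τ * ∏ i, marg a K L (X i) τ) /
    ∫ s in Set.Icc lo hi, π2 s * ∏ i, marg a K L (X i) s

/-- Full Bayes posterior mean `θ̂_i = ∫ T_τ(X_i) π_{2n}(τ|X) dτ`. -/
def fbMean (a K : ℝ) (L : ℝ → ℝ) (π2 : ℝ → ℝ) (n : ℕ) (X : Fin n → ℝ) (i : Fin n) : ℝ :=
  ∫ τ in Set.Icc ((n:ℝ)⁻¹) 1, postMean a L τ (X i) * tauWeight a K L π2 ((n:ℝ)⁻¹) 1 n X τ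

/-- Full Bayes posterior variance `Var(θ_i | X)`. -/
def fbVar (a K : ℝ) (L : ℝ → ℝ) (π2 : ℝ → ℝ) (n : ℕ) (X : Fin n → ℝ) (i : Fin n) : ℝ :=
  (∫ τ in Set.Icc ((n:ℝ)⁻¹) 1,
      (postVar a L (X i) τ + (postMean a L τ (X i))^2) * tauWeight a K L π2 ((n:ℝ)⁻¹) 1 n X τ)
    - (fbMean a K L π2 n X i)^2

/-- The posterior distribution of `τ` given `X`, as a measure on `[lo, hi]`. -/
def tauPostMeasure (a K : ℝ) (L : ℝ → ℝ) (π2 : ℝ → ℝ) (lo hi : ℝ) (n : ℕ)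
    (X : Fin n → ℝ) : Measure ℝ :=
  (∫⁻ τ in Set.Icc lo hi, ENNReal.ofReal (π2 τ * ∏ i, marg a K L (X i) τ))⁻¹ •
    ((volume.restrict (Set.Icc lo hi)).withDensity
      fun τ => ENNReal.ofReal (π2 τ * ∏ i, marg a K L (X i) τ))

/-- The full Bayes posterior `Π(· | X)` of `θ` given `X`. -/
def PiFull (a K : ℝ) (L : ℝ → ℝ) (π2 : ℝ → ℝ) (n : ℕ) (X : Fin n → ℝ) :
    Measure (Fin n → ℝ) :=
  (tauPostMeasure a K L π2 ((n:ℝ)⁻¹) 1 n X).bind fun τ => PiTau a L n X τ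

/-- Condition (C1): `π_{2n}` is a density supported on `[1/n, 1]`. -/
def CondC1 (π2 : ℕ → ℝ → ℝ) : Prop :=
  (∀ (n : ℕ) (τ : ℝ), 0 ≤ π2 n τ) ∧ (∀ (n : ℕ) (τ : ℝ), τ ∉ Set.Icc ((n:ℝ)⁻¹) 1 → π2 n τ = 0) ∧
    ∀ n : ℕ, 1 ≤ n → ∫ τ in Set.Icc ((n:ℝ)⁻¹) 1, π2 n τ = 1

/-- `t_n = C_u π^{3/2} (q_n/n) √(log(n/q_n))`. -/
def tseq (Cu : ℝ) (q : ℕ → ℕ) (n : ℕ) : ℝ :=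
  Cu * Real.pi ^ ((3:ℝ)/2) * ((q n : ℝ)/n) * Real.sqrt (Real.log ((n:ℝ)/(q n)))

/-- Condition (C2). -/
def CondC2 (π2 : ℕ → ℝ → ℝ) (q : ℕ → ℕ) : Prop :=
  ∃ Cu c M1 K' : ℝ, 0 < Cu ∧ c ≤ Cu/2 ∧ 1 ≤ M1 ∧ 0 < K' ∧
    ∀ᶠ n : ℕ in atTop,
      K' * Real.exp (-c * q n) ≤
        ((q n : ℝ)/n)^M1 * ∫ τ in Set.Icc (tseq Cu q n / 2) (tseq Cu q n), π2 n τ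

/-- Full Bayes posterior shrinkage weight `E(1−κ_i | X)`. -/
def fbShrink (a K : ℝ) (L : ℝ → ℝ) (π2 : ℝ → ℝ) (lo hi : ℝ) (n : ℕ)
    (X : Fin n → ℝ) (i : Fin n) : ℝ :=
  ∫ τ in Set.Icc lo hi, E1mK a L (X i) τ * tauWeight a K L π2 lo hi n X τ

/-- Marginal two-groups distribution of one observation:
`(1−p) N(0,1) + p N(0, 1+ψ²)` with `u = ψ²`. -/
def mixM (p u : ℝ) : Measure ℝ :=
  ENNReal.ofReal (1 - p) • gaussianReal 0 1 +
    ENNReal.ofReal p • gaussianReal 0 (Real.toNNReal (1 + u))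

/-- Joint law of `X` given `ν_i = 0`. -/
def nullMeas (n : ℕ) (i : Fin n) (p u : ℝ) : Measure (Fin n → ℝ) :=
  Measure.pi fun j => if j = i then gaussianReal 0 1 else mixM p u

/-- Joint law of `X` given `ν_i = 1`. -/
def altMeas (n : ℕ) (i : Fin n) (p u : ℝ) : Measure (Fin n → ℝ) :=
  Measure.pi fun j => if j = i then gaussianReal 0 (Real.toNNReal (1 + u)) else mixM p u

/-- Type I error `t^{FB}_{1i}` of the full Bayes rule. -/
def t1FB (a K : ℝ) (L : ℝ → ℝ) (π2 : ℕ → ℝ → ℝ) (α : ℕ → ℝ) (p u : ℕ → ℝ)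
    (n : ℕ) (i : Fin n) : ℝ :=
  ((nullMeas n i (p n) (u n))
    {x | 1/2 < fbShrink a K L (π2 n) ((n:ℝ)⁻¹) (α n) n x i}).toReal

/-- Type II error `t^{FB}_{2i}` of the full Bayes rule. -/
def t2FB (a K : ℝ) (L : ℝ → ℝ) (π2 : ℕ → ℝ → ℝ) (α : ℕ → ℝ) (p u : ℕ → ℝ)
    (n : ℕ) (i : Fin n) : ℝ :=
  ((altMeas n i (p n) (u n))
    {x | fbShrink a K L (π2 n) ((n:ℝ)⁻¹) (α n) n x i ≤ 1/2}).toReal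

/-- Bayes risk `R^{FB}_{OG}` of the full Bayes rule. -/
def RFB (a K : ℝ) (L : ℝ → ℝ) (π2 : ℕ → ℝ → ℝ) (α : ℕ → ℝ) (p u : ℕ → ℝ) (n : ℕ) : ℝ :=
  ∑ i : Fin n, ((1 - p n) * t1FB a K L π2 α p u n i + p n * t2FB a K L π2 α p u n i)

/-- Condition (C3): `π_{2n}` is a density supported on `[1/n, α_n]`,
with `α_n → 0` and `n α_n → ∞`. -/
def CondC3 (π2 : ℕ → ℝ → ℝ) (α : ℕ → ℝ) : Prop :=
  (∀ (n : ℕ) (τ : ℝ), 0 ≤ π2 n τ) ∧ (∀ (n : ℕ) (τ : ℝ), τ ∉ Set.Icc ((n:ℝ)⁻¹) (α n) → π2 n τ = 0) ∧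
    (∀ n : ℕ, 1 ≤ n → ∫ τ in Set.Icc ((n:ℝ)⁻¹) (α n), π2 n τ = 1) ∧
    Tendsto α atTop (nhds 0) ∧ Tendsto (fun n : ℕ => (n:ℝ) * α n) atTop atTop

/-- Assumption 2 of Bogdan et al.: `p_n → 0`, `u_n = ψ_n² → ∞`,
`log v_n / u_n → C ∈ (0,∞)` with `v_n = u_n f_n²`, `f_n = (1-p_n)/p_n`. -/
def Assump2 (p u : ℕ → ℝ) (C : ℝ) : Prop :=
  Tendsto p atTop (nhds 0) ∧ Tendsto u atTop atTop ∧ 0 < C ∧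
    Tendsto (fun n => Real.log (u n * ((1 - p n)/p n)^2) / u n) atTop (nhds C)

/-- Standard normal cdf. -/
def Phi (z : ℝ) : ℝ := ((gaussianReal 0 1) (Set.Iic z)).toReal

/-- Squared threshold of the Bayes Oracle. -/
def csq (p u : ℕ → ℝ) (n : ℕ) : ℝ :=
  ((1 + u n)/u n) * (Real.log (1 + u n) + 2 * Real.log ((1 - p n)/p n))

/-- Type I error of the Bayes Oracle. -/
def t1BO (p u : ℕ → ℝ) (n : ℕ) : ℝ :=
  ((gaussianReal 0 1) {x : ℝ | csq p u n < x^2}).toReal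

/-- Type II error of the Bayes Oracle. -/
def t2BO (p u : ℕ → ℝ) (n : ℕ) : ℝ :=
  ((gaussianReal 0 (Real.toNNReal (1 + u n))) {x : ℝ | x^2 ≤ csq p u n}).toReal

/-- Bayes risk of the Bayes Oracle. -/
def RBO (p u : ℕ → ℝ) (n : ℕ) : ℝ :=
  (n:ℝ) * ((1 - p n) * t1BO p u n + p n * t2BO p u n)

end PaperGL

namespace PaperGL

/-- The distribution function of the square of a standard normal variable. -/
def gaussSqCdf (s : ℝ) : ℝ := (gaussianReal 0 1).real {z | z ^ 2 ≤ s}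

lemma measurableSet_sq_le (s : ℝ) : MeasurableSet {z : ℝ | z ^ 2 ≤ s} :=
  measurableSet_le (by fun_prop) (by fun_prop)

lemma measurableSet_lt_sq (s : ℝ) : MeasurableSet {z : ℝ | s < z ^ 2} :=
  measurableSet_lt (by fun_prop) (by fun_prop)

lemma gaussSqCdf_eq_intervalIntegral (s : ℝ) :
    gaussSqCdf s = ∫ z in (-√s)..√s, gaussianPDFReal 0 1 z := by
  have h0 : 0 ≤ √s := Real.sqrt_nonneg s
  rw [intervalIntegral.integral_of_le (by linarith), ← integral_Icc_eq_integral_Ioc,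
    gaussSqCdf, measureReal_def]
  rcases lt_or_ge s 0 with hs | hs
  · have : {z : ℝ | z ^ 2 ≤ s} = ∅ := by
      ext z
      simpa using hs.trans_le (sq_nonneg z)
    rw [this, Real.sqrt_eq_zero_of_nonpos hs.le]
    simp
  · have : {z : ℝ | z ^ 2 ≤ s} = Icc (-√s) √s := by
      ext z
      rw [mem_ofPred_eq, mem_Icc, ← abs_le, Real.le_sqrt (abs_nonneg z) hs, sq_abs]
    rw [this, gaussianReal_apply_eq_integral _ one_ne_zero, ENNReal.toReal_ofReal]
    exact integral_nonneg fun z => gaussianPDFReal_nonneg 0 1 z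

lemma continuous_gaussSqCdf : Continuous gaussSqCdf := by
  have hint : ∀ a b : ℝ, IntervalIntegrable (gaussianPDFReal 0 1) volume a b :=
    fun a b => (integrable_gaussianPDFReal 0 1).intervalIntegrable
  have hF : Continuous fun b : ℝ => ∫ z in (0 : ℝ)..b, gaussianPDFReal 0 1 z :=
    intervalIntegral.continuous_primitive hint 0
  have : gaussSqCdf = fun s => (∫ z in (0 : ℝ)..√s, gaussianPDFReal 0 1 z) -
      ∫ z in (0 : ℝ)..(-√s), gaussianPDFReal 0 1 z := by
    funext s
    rw [gaussSqCdf_eq_intervalIntegral,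
      intervalIntegral.integral_interval_sub_left (hint _ _) (hint _ _)]
  rw [this]
  exact (hF.comp Real.continuous_sqrt).sub (hF.comp Real.continuous_sqrt.neg)

lemma gaussSqCdf_pos {s : ℝ} (hs : 0 < s) : 0 < gaussSqCdf s := by
  rw [gaussSqCdf_eq_intervalIntegral]
  have : 0 < √s := Real.sqrt_pos.2 hs
  exact intervalIntegral.intervalIntegral_pos_of_pos
    (integrable_gaussianPDFReal 0 1).intervalIntegrable
    (fun z => gaussianPDFReal_pos 0 1 z one_ne_zero) (by linarith)

lemma gaussianReal_zero_sq_le {v : ℝ} (hv : 0 < v) (s : ℝ) :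
    (gaussianReal 0 v.toNNReal).real {x | x ^ 2 ≤ s} = gaussSqCdf (s / v) := by
  have hmap := gaussianReal_map_const_mul (μ := 0) (v := 1) √v
  have hvar : NNReal.mk (√v ^ 2) (sq_nonneg _) * 1 = v.toNNReal := by
    ext
    simp [Real.sq_sqrt hv.le, hv.le]
  rw [mul_zero, hvar] at hmap
  rw [← hmap, map_measureReal_apply (by fun_prop) (measurableSet_sq_le s), gaussSqCdf]
  congr 1
  ext z
  simp only [mem_preimage, mem_ofPred_eq, mul_pow, Real.sq_sqrt hv.le]
  rw [le_div_iff₀ hv, mul_comm]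

lemma gaussianReal_Ioi_le {r : ℝ} (hr : 0 < r) :
    (gaussianReal 0 1).real (Ioi r) ≤ Real.exp (-(r ^ 2) / 2) / (2 * r) := by
  set φ := gaussianPDFReal 0 1 with hφ
  have hφeq : ∀ z, φ z = (√(2 * π))⁻¹ * Real.exp (-(z ^ 2) / 2) := by
    intro z
    simp [hφ, gaussianPDFReal]
  have hderiv : ∀ z ∈ Ici r, HasDerivAt (fun z => -φ z / r) (z / r * φ z) z := by
    intro z _
    have h1 : HasDerivAt (fun z : ℝ => -(z ^ 2) / 2) (-z) z := by
      refine ((hasDerivAt_pow 2 z).neg.div_const 2).congr_deriv ?_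
      norm_num
      ring
    have h2 := ((h1.exp.const_mul (√(2 * π))⁻¹).neg).div_const r
    have h3 : (fun z => -φ z / r) = fun z => -((√(2 * π))⁻¹ * Real.exp (-(z ^ 2) / 2)) / r := by
      funext y
      rw [hφeq]
    rw [h3, hφeq]
    refine h2.congr_deriv ?_
    ring
  have hnonneg : ∀ z ∈ Ioi r, 0 ≤ z / r * φ z := fun z hz =>
    mul_nonneg (div_nonneg (hr.le.trans (le_of_lt hz)) hr.le) (gaussianPDFReal_nonneg 0 1 z)
  have hlim : Tendsto (fun z => -φ z / r) atTop (nhds 0) := by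
    have h1 : Tendsto (fun z : ℝ => -(z ^ 2) / 2) atTop atBot := by
      have : Tendsto (fun z : ℝ => z ^ 2 / 2) atTop atTop :=
        (tendsto_pow_atTop two_ne_zero).atTop_div_const two_pos
      simpa [neg_div] using this
    have h2 := ((Real.tendsto_exp_atBot.comp h1).const_mul (√(2 * π))⁻¹).neg.div_const r
    simpa [Function.comp_def, hφeq] using h2
  have hint := integrableOn_Ioi_deriv_of_nonneg' hderiv hnonneg hlim
  have hval := integral_Ioi_of_hasDerivAt_of_nonneg' hderiv hnonneg hlim
  rw [measureReal_def, gaussianReal_apply_eq_integral _ one_ne_zero, ENNReal.toReal_ofReal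
    (integral_nonneg fun z => gaussianPDFReal_nonneg 0 1 z)]
  have hle : ∫ z in Ioi r, φ z ≤ ∫ z in Ioi r, z / r * φ z := by
    refine setIntegral_mono_on (integrable_gaussianPDFReal 0 1).integrableOn hint
      measurableSet_Ioi fun z hz => ?_
    exact le_mul_of_one_le_left (gaussianPDFReal_nonneg 0 1 z)
      ((one_le_div hr).2 (le_of_lt hz))
  refine hle.trans ?_
  rw [hval, hφeq]
  have hsqrt : (√(2 * π))⁻¹ ≤ 2⁻¹ := by
    refine inv_anti₀ two_pos (Real.le_sqrt_of_sq_le ?_)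
    linarith [Real.pi_gt_three]
  have he := Real.exp_pos (-(r ^ 2) / 2)
  calc 0 - -((√(2 * π))⁻¹ * Real.exp (-(r ^ 2) / 2)) / r
      = (√(2 * π))⁻¹ * (Real.exp (-(r ^ 2) / 2) / r) := by ring
    _ ≤ 2⁻¹ * (Real.exp (-(r ^ 2) / 2) / r) := by gcongr
    _ = Real.exp (-(r ^ 2) / 2) / (2 * r) := by field_simp

/-- Mills-ratio bound for the two-sided tail of a standard normal variable. -/
lemma gaussianReal_lt_sq_le {s : ℝ} (hs : 0 < s) :
    (gaussianReal 0 1).real {z | s < z ^ 2} ≤ Real.exp (-s / 2) / √s := by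
  have hr : 0 < √s := Real.sqrt_pos.2 hs
  have hset : {z : ℝ | s < z ^ 2} = Ioi √s ∪ (fun z => -z) ⁻¹' Ioi √s := by
    ext z
    simp only [mem_ofPred_eq, mem_union, mem_preimage, mem_Ioi]
    rw [← Real.sqrt_lt_sqrt_iff hs.le, Real.sqrt_sq_eq_abs, lt_abs]
  have hneg : (gaussianReal 0 1).real ((fun z => -z) ⁻¹' Ioi √s) =
      (gaussianReal 0 1).real (Ioi √s) := by
    have h := gaussianReal_map_neg (μ := 0) (v := 1)
    rw [neg_zero] at h
    conv_rhs => rw [← h]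
    rw [map_measureReal_apply (by fun_prop) measurableSet_Ioi]
  have hb := gaussianReal_Ioi_le hr
  rw [Real.sq_sqrt hs.le] at hb
  rw [hset]
  refine (measureReal_union_le _ _).trans ?_
  rw [hneg]
  calc _ ≤ Real.exp (-s / 2) / (2 * √s) + Real.exp (-s / 2) / (2 * √s) := add_le_add hb hb
    _ = Real.exp (-s / 2) / √s := by field_simp; norm_num

lemma isProbabilityMeasure_mixM {p u : ℝ} (h0 : 0 ≤ p) (h1 : p ≤ 1) :
    IsProbabilityMeasure (mixM p u) := by
  refine ⟨?_⟩
  simp only [mixM, Measure.coe_add, Measure.coe_smul, Pi.add_apply, Pi.smul_apply, measure_univ,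
    smul_eq_mul, mul_one]
  rw [← ENNReal.ofReal_add (by linarith) h0]
  simp

/-- Replacing one factor of a product of copies of a probability measure by `μ`, the corresponding
coordinate has law `μ`. -/
lemma pi_update_preimage_eval {ι : Type*} [Fintype ι] [DecidableEq ι] (i : ι) (μ ν : Measure ℝ)
    [IsProbabilityMeasure μ] [IsProbabilityMeasure ν] {S : Set ℝ} (hS : MeasurableSet S) :
    (Measure.pi fun j => if j = i then μ else ν) {x : ι → ℝ | x i ∈ S} = μ S := by
  have : ∀ j, IsProbabilityMeasure (if j = i then μ else ν) := fun j => by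
    split_ifs <;> infer_instance
  have h := measurePreserving_eval (fun j => if j = i then μ else ν) i
  have h' := h.measure_preimage hS.nullMeasurableSet
  rwa [if_pos rfl] at h'

/-- The posterior density kernel of `κ` with `a = 1/2`, stripped of its exponential tilt. -/
def kBase (L : ℝ → ℝ) (τ κ : ℝ) : ℝ :=
  (1 - κ) ^ (-(1/2 : ℝ) - 1) * L ((1/τ^2) * (1/κ - 1))

lemma kdens_half (L : ℝ → ℝ) (x τ κ : ℝ) :
    kdens (1/2) L x τ κ = kBase L τ κ * Real.exp ((1 - κ) * x^2 / 2) := by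
  simp [kdens, kBase]

lemma kArg_pos {τ κ : ℝ} (hτ : 0 < τ) (hκ : κ ∈ Ioo (0 : ℝ) 1) :
    0 < (1/τ^2) * (1/κ - 1) := by
  have : 1 < 1 / κ := (one_lt_div hκ.1).2 hκ.2
  have : 0 < 1 / κ - 1 := by linarith
  positivity

lemma kBase_pos {L : ℝ → ℝ} (hpos : ∀ t, 0 < t → 0 < L t) {τ κ : ℝ} (hτ : 0 < τ)
    (hκ : κ ∈ Ioo (0 : ℝ) 1) : 0 < kBase L τ κ :=
  mul_pos (Real.rpow_pos_of_pos (by linarith [hκ.2]) _) (hpos _ (kArg_pos hτ hκ))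

lemma kdens_half_pos {L : ℝ → ℝ} (hpos : ∀ t, 0 < t → 0 < L t) {x τ κ : ℝ} (hτ : 0 < τ)
    (hκ : κ ∈ Ioo (0 : ℝ) 1) : 0 < kdens (1/2) L x τ κ := by
  rw [kdens_half]
  exact mul_pos (kBase_pos hpos hτ hκ) (Real.exp_pos _)

lemma measurable_kBase {L : ℝ → ℝ} (hL : Measurable L) (τ : ℝ) : Measurable (kBase L τ) := by
  unfold kBase
  fun_prop

lemma measurable_kdens_uncurry {L : ℝ → ℝ} (hL : Measurable L) (x : ℝ) :
    Measurable (fun q : ℝ × ℝ => kdens (1/2) L x q.1 q.2) := by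
  unfold kdens
  fun_prop

lemma image_shrink_Ioi {τ : ℝ} (hτ : 0 < τ) :
    (fun t : ℝ => (1 + t * τ^2)⁻¹) '' Ioi 0 = Ioo 0 1 := by
  ext κ
  constructor
  · rintro ⟨t, ht, rfl⟩
    have ht' : 0 < t * τ^2 := mul_pos ht (by positivity)
    exact ⟨by positivity, inv_lt_one_of_one_lt₀ (by linarith)⟩
  · intro hκ
    refine ⟨(1/τ^2) * (1/κ - 1), kArg_pos hτ hκ, ?_⟩
    have := hκ.1
    field_simp
    simp

lemma sq_rpow_neg_half_sub_one {τ : ℝ} (hτ : 0 < τ) :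
    (τ^2) ^ (-(1/2 : ℝ) - 1) = (τ^3)⁻¹ := by
  rw [← Real.rpow_natCast τ 2, ← Real.rpow_mul hτ.le, ← Real.rpow_natCast τ 3,
    ← Real.rpow_neg hτ.le]
  norm_num

lemma shrink_jacobian_le {L : ℝ → ℝ} (hpos : ∀ t, 0 < t → 0 < L t) {τ t : ℝ} (hτ : 0 < τ)
    (ht : 0 < t) :
    |-(τ^2) / (1 + t * τ^2)^2| * kBase L τ (1 + t * τ^2)⁻¹ ≤
      τ⁻¹ * (t ^ (-(1/2 : ℝ) - 1) * L t) := by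
  have hs : 0 < t * τ^2 := by positivity
  have harg : (1/τ^2) * (1/(1 + t * τ^2)⁻¹ - 1) = t := by field_simp; ring
  have hsub : 1 - (1 + t * τ^2)⁻¹ = t * τ^2 / (1 + t * τ^2) := by field_simp; ring
  have hle : (1 + t * τ^2) ^ (-(-(1/2 : ℝ) - 1)) ≤ (1 + t * τ^2)^2 := by
    rw [← Real.rpow_natCast (1 + t * τ^2) 2]
    exact Real.rpow_le_rpow_of_exponent_le (by linarith) (by norm_num)
  have hLt := hpos t ht
  have htp : 0 < t ^ (-(1/2 : ℝ) - 1) := Real.rpow_pos_of_pos ht _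
  have hquot : (t * τ^2 / (1 + t * τ^2)) ^ (-(1/2 : ℝ) - 1) =
      t ^ (-(1/2 : ℝ) - 1) * (τ^3)⁻¹ * (1 + t * τ^2) ^ (-(-(1/2 : ℝ) - 1)) := by
    rw [Real.div_rpow hs.le (by linarith), Real.mul_rpow ht.le (by positivity),
      sq_rpow_neg_half_sub_one hτ, Real.rpow_neg (by linarith) (-(1/2 : ℝ) - 1), div_eq_mul_inv]
  rw [kBase, harg, hsub, hquot, abs_div, abs_neg, abs_of_pos (by positivity : 0 < τ^2),
    abs_of_pos (by positivity : 0 < (1 + t * τ^2)^2)]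
  calc τ^2 / (1 + t * τ^2)^2 * (t ^ (-(1/2 : ℝ) - 1) * (τ^3)⁻¹ *
        (1 + t * τ^2) ^ (-(-(1/2 : ℝ) - 1)) * L t)
      ≤ τ^2 / (1 + t * τ^2)^2 * (t ^ (-(1/2 : ℝ) - 1) * (τ^3)⁻¹ * (1 + t * τ^2)^2 * L t) := by
        gcongr
    _ = τ⁻¹ * (t ^ (-(1/2 : ℝ) - 1) * L t) := by field_simp

lemma kBase_integrableOn_and_integral_le {L : ℝ → ℝ} (hL : Measurable L)
    (hpos : ∀ t, 0 < t → 0 < L t)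
    (hint : IntegrableOn (fun t => t ^ (-(1/2 : ℝ) - 1) * L t) (Ioi 0)) {τ : ℝ} (hτ : 0 < τ) :
    IntegrableOn (kBase L τ) (Ioo 0 1) ∧
      ∫ κ in Ioo (0 : ℝ) 1, kBase L τ κ ≤
        τ⁻¹ * ∫ t in Ioi (0 : ℝ), t ^ (-(1/2 : ℝ) - 1) * L t := by
  have hderiv : ∀ t ∈ Ioi (0 : ℝ), HasDerivWithinAt (fun t : ℝ => (1 + t * τ^2)⁻¹)
      (-(τ^2) / (1 + t * τ^2)^2) (Ioi 0) t := by
    intro t ht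
    have ht' : 0 < t * τ^2 := mul_pos ht (by positivity)
    have h1 : HasDerivAt (fun t : ℝ => 1 + t * τ^2) (τ^2) t := by
      simpa using ((hasDerivAt_id t).mul_const (τ^2)).const_add 1
    exact (h1.inv (by linarith)).hasDerivWithinAt
  have hinj : InjOn (fun t : ℝ => (1 + t * τ^2)⁻¹) (Ioi 0) := by
    intro s _ t _ hst
    have := inv_injective hst
    have hτ2 : τ^2 ≠ 0 := by positivity
    exact mul_right_cancel₀ hτ2 (by linarith)
  have hbound : ∀ t ∈ Ioi (0 : ℝ),
      |-(τ^2) / (1 + t * τ^2)^2| • kBase L τ (1 + t * τ^2)⁻¹ ≤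
        τ⁻¹ * (t ^ (-(1/2 : ℝ) - 1) * L t) := fun t ht => shrink_jacobian_le hpos hτ ht
  have hnonneg : ∀ t ∈ Ioi (0 : ℝ),
      0 ≤ |-(τ^2) / (1 + t * τ^2)^2| • kBase L τ (1 + t * τ^2)⁻¹ := fun t ht =>
    mul_nonneg (abs_nonneg _) (kBase_pos hpos hτ
      (image_shrink_Ioi hτ ▸ mem_image_of_mem _ ht)).le
  have hmeas : Measurable fun t : ℝ =>
      |-(τ^2) / (1 + t * τ^2)^2| • kBase L τ (1 + t * τ^2)⁻¹ := by
    have := measurable_kBase hL τ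
    fun_prop
  have hint' : IntegrableOn (fun t : ℝ =>
      |-(τ^2) / (1 + t * τ^2)^2| • kBase L τ (1 + t * τ^2)⁻¹) (Ioi 0) := by
    refine Integrable.mono' (hint.const_mul τ⁻¹) hmeas.aestronglyMeasurable ?_
    filter_upwards [ae_restrict_mem measurableSet_Ioi] with t ht
    rw [Real.norm_of_nonneg (hnonneg t ht)]
    exact hbound t ht
  rw [← image_shrink_Ioi hτ]
  refine ⟨(integrableOn_image_iff_integrableOn_abs_deriv_smul measurableSet_Ioi hderiv hinj _).2
    hint', ?_⟩
  rw [integral_image_eq_integral_abs_deriv_smul measurableSet_Ioi hderiv hinj,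
    ← integral_const_mul]
  exact setIntegral_mono_on hint' (hint.const_mul _) measurableSet_Ioi hbound

lemma tilt_le {x κ c : ℝ} (h : 1 - κ ≤ c) :
    Real.exp ((1 - κ) * x^2 / 2) ≤ Real.exp (c * x^2 / 2) := by
  gcongr

lemma integrableOn_kdens_half {L : ℝ → ℝ} (hL : Measurable L) (hpos : ∀ t, 0 < t → 0 < L t)
    (hint : IntegrableOn (fun t => t ^ (-(1/2 : ℝ) - 1) * L t) (Ioi 0)) {τ : ℝ} (hτ : 0 < τ)
    (x : ℝ) : IntegrableOn (kdens (1/2) L x τ) (Ioo 0 1) := by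
  have hbase := (kBase_integrableOn_and_integral_le hL hpos hint hτ).1
  have hmeas : Measurable (kdens (1/2) L x τ) :=
    (measurable_kdens_uncurry hL x).comp measurable_prodMk_left
  refine Integrable.mono' (hbase.mul_const (Real.exp (1 * x^2 / 2))) hmeas.aestronglyMeasurable ?_
  filter_upwards [ae_restrict_mem measurableSet_Ioo] with κ hκ
  rw [Real.norm_of_nonneg (kdens_half_pos hpos hτ hκ).le, kdens_half]
  exact mul_le_mul_of_nonneg_left (tilt_le (by linarith [hκ.1])) (kBase_pos hpos hτ hκ).le

lemma mul_sub_le_setIntegral_Ioo {f : ℝ → ℝ} {a b m : ℝ} (hf : IntegrableOn f (Ioo 0 1))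
    (h0 : ∀ κ ∈ Ioo (0 : ℝ) 1, 0 ≤ f κ) (ha : 0 < a) (hab : a ≤ b) (hb : b < 1)
    (hm : ∀ κ ∈ Icc a b, m ≤ f κ) : (b - a) * m ≤ ∫ κ in Ioo (0 : ℝ) 1, f κ := by
  have hsub : Icc a b ⊆ Ioo 0 1 := fun κ hκ => ⟨ha.trans_le hκ.1, hκ.2.trans_lt hb⟩
  calc (b - a) * m = ∫ _ in Icc a b, m := by simp [Measure.real, hab]
    _ ≤ ∫ κ in Icc a b, f κ :=
        setIntegral_mono_on (integrableOn_const (by simp)) (hf.mono_set hsub) measurableSet_Icc hm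
    _ ≤ ∫ κ in Ioo (0 : ℝ) 1, f κ :=
        setIntegral_mono_set hf ((ae_restrict_mem measurableSet_Ioo).mono h0)
          hsub.eventuallyLE

lemma integrableOn_one_sub_rpow : IntegrableOn (fun κ : ℝ => (1 - κ) ^ (-(1/2) : ℝ)) (Ioo 0 1) := by
  have h : IntervalIntegrable (fun κ : ℝ => κ ^ (-(1/2) : ℝ)) volume 1 0 :=
    intervalIntegral.intervalIntegrable_rpow' (by norm_num)
  have h' := h.comp_sub_left 1
  rw [sub_self, sub_zero, intervalIntegrable_iff_integrableOn_Ioo_of_le zero_le_one] at h'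
  exact h'

/-- The spike of the posterior of `κ` at `1` has mass of order at least `τ⁻¹`. -/
lemma div_le_integral_kdens {L : ℝ → ℝ} {Mb c0 t0 : ℝ} (hL : AssumpL L Mb c0 t0)
    (hint : IntegrableOn (fun t => t ^ (-(1/2 : ℝ) - 1) * L t) (Ioi 0)) {τ : ℝ} (hτ : 0 < τ)
    (hτ' : t0 * τ^2 ≤ 1) (x : ℝ) :
    t0 / 6 * (2 * t0) ^ (-(1/2 : ℝ) - 1) * c0 / τ ≤ ∫ κ in Ioo (0 : ℝ) 1, kdens (1/2) L x τ κ := by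
  obtain ⟨hm, hpos, -, hc0, ht0, hc⟩ := hL
  set s := t0 * τ^2 with hs
  have hs0 : 0 < s := by positivity
  have hlow : ∀ κ ∈ Icc (1 / (1 + 2 * s)) (1 / (1 + s)),
      (2 * s) ^ (-(1/2 : ℝ) - 1) * c0 ≤ kdens (1/2) L x τ κ := by
    intro κ hκ
    have hκ0 : 0 < κ := lt_of_lt_of_le (by positivity) hκ.1
    have hκ1 : κ < 1 := lt_of_le_of_lt hκ.2 ((div_lt_one (by linarith)).2 (by linarith))
    have harg : t0 ≤ (1/τ^2) * (1/κ - 1) := by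
      have h1 : 1 + s ≤ 1 / κ := by
        rw [le_div_iff₀ hκ0, mul_comm, ← le_div_iff₀ (by linarith)]
        exact hκ.2
      calc t0 = (1/τ^2) * s := by rw [hs]; field_simp
        _ ≤ (1/τ^2) * (1/κ - 1) := by gcongr; linarith
    have hsub : 1 - κ ≤ 2 * s := by
      have h1 : 1 ≤ κ * (1 + 2 * s) := (div_le_iff₀ (by linarith)).1 hκ.1
      nlinarith
    have hpow : (2 * s) ^ (-(1/2 : ℝ) - 1) ≤ (1 - κ) ^ (-(1/2 : ℝ) - 1) :=
      Real.rpow_le_rpow_of_nonpos (by linarith) hsub (by norm_num)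
    have hexp : 1 ≤ Real.exp ((1 - κ) * x^2 / 2) := by
      refine Real.one_le_exp ?_
      have : 0 < 1 - κ := by linarith
      positivity
    have hb : (2 * s) ^ (-(1/2 : ℝ) - 1) * c0 ≤ kBase L τ κ :=
      mul_le_mul hpow (hc _ harg) hc0.le (Real.rpow_nonneg (by linarith) _)
    rw [kdens_half]
    exact hb.trans (le_mul_of_one_le_right (kBase_pos hpos hτ ⟨hκ0, hκ1⟩).le hexp)
  have hlen : s / 6 ≤ 1 / (1 + s) - 1 / (1 + 2 * s) := by
    rw [div_sub_div _ _ (by linarith) (by linarith), div_le_div_iff₀ (by norm_num) (by positivity)]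
    nlinarith [mul_nonneg hs0.le (sub_nonneg.2 hτ'), mul_nonneg (mul_nonneg hs0.le hs0.le)
      (sub_nonneg.2 hτ')]
  have hfin := mul_sub_le_setIntegral_Ioo (integrableOn_kdens_half hm hpos hint hτ x)
    (fun κ hκ => (kdens_half_pos hpos hτ hκ).le) (by positivity)
    (one_div_le_one_div_of_le (by linarith) (by linarith))
    ((div_lt_one (by linarith)).2 (by linarith)) hlow
  refine le_trans ?_ hfin
  have hp : 0 < (2 * s) ^ (-(1/2 : ℝ) - 1) := Real.rpow_pos_of_pos (by linarith) _
  calc t0 / 6 * (2 * t0) ^ (-(1/2 : ℝ) - 1) * c0 / τ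
      = s / 6 * ((2 * t0) ^ (-(1/2 : ℝ) - 1) * (τ^3)⁻¹ * c0) := by rw [hs]; field_simp
    _ = s / 6 * ((2 * s) ^ (-(1/2 : ℝ) - 1) * c0) := by
        rw [hs, ← mul_assoc 2, Real.mul_rpow (x := 2 * t0) (y := τ^2) (by positivity) (by positivity),
          sq_rpow_neg_half_sub_one hτ]
    _ ≤ _ := by gcongr

/-- Upper bound on the posterior shrinkage weight, linear in the global parameter `τ`. -/
lemma exists_E1mK_le {L : ℝ → ℝ} {Mb c0 t0 : ℝ} (hL : AssumpL L Mb c0 t0)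
    (hint : IntegrableOn (fun t => t ^ (-(1/2 : ℝ) - 1) * L t) (Ioi 0)) :
    ∃ B : ℝ, 0 < B ∧ ∀ τ x : ℝ, 0 < τ → t0 * τ^2 ≤ 1 →
      E1mK (1/2) L x τ ≤ B * τ * Real.exp (x^2 / 2) := by
  have hD := fun τ hτ hτ' x => div_le_integral_kdens hL hint (τ := τ) hτ hτ' x
  obtain ⟨hm, hpos, hM, hc0, ht0, hc⟩ := hL
  have hMb : 0 < Mb := (hpos 1 one_pos).trans_le (hM 1 one_pos)
  set J := ∫ κ in Ioo (0 : ℝ) 1, (1 - κ) ^ (-(1/2) : ℝ) with hJ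
  have hJ0 : 0 ≤ J := setIntegral_nonneg measurableSet_Ioo fun κ hκ =>
    Real.rpow_nonneg (by linarith [hκ.2]) _
  set d := t0 / 6 * (2 * t0) ^ (-(1/2 : ℝ) - 1) * c0 with hd
  have hd0 : 0 < d := by positivity
  refine ⟨(Mb * J + 1) / d, by positivity, fun τ x hτ hτ' => ?_⟩
  have hN : ∫ κ in Ioo (0 : ℝ) 1, (1 - κ) * kdens (1/2) L x τ κ ≤
      Mb * J * Real.exp (x^2 / 2) := by
    have h : ∫ κ in Ioo (0 : ℝ) 1, (1 - κ) * kdens (1/2) L x τ κ ≤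
        ∫ κ in Ioo (0 : ℝ) 1, Mb * Real.exp (x^2 / 2) * (1 - κ) ^ (-(1/2) : ℝ) := by
      refine integral_mono_of_nonneg ?_ (integrableOn_one_sub_rpow.const_mul _) ?_
      · filter_upwards [ae_restrict_mem measurableSet_Ioo] with κ hκ
        exact mul_nonneg (by linarith [hκ.2]) (kdens_half_pos hpos hτ hκ).le
      · filter_upwards [ae_restrict_mem measurableSet_Ioo] with κ hκ
        have h1 : 0 < 1 - κ := by linarith [hκ.2]
        have hpow : (1 - κ) * (1 - κ) ^ (-(1/2 : ℝ) - 1) = (1 - κ) ^ (-(1/2) : ℝ) := by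
          rw [Real.rpow_sub_one h1.ne']
          field_simp
        have hexp : Real.exp ((1 - κ) * x^2 / 2) ≤ Real.exp (x^2 / 2) := by
          simpa using tilt_le (x := x) (c := 1) (by linarith [hκ.1] : 1 - κ ≤ 1)
        have hp := Real.rpow_nonneg h1.le (-(1/2) : ℝ)
        rw [kdens_half, kBase]
        calc _ = (1 - κ) * (1 - κ) ^ (-(1/2 : ℝ) - 1) * L ((1/τ^2) * (1/κ - 1)) *
              Real.exp ((1 - κ) * x^2 / 2) := by ring
          _ ≤ (1 - κ) ^ (-(1/2) : ℝ) * Mb * Real.exp (x^2 / 2) := by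
              rw [hpow]
              gcongr
              exact hM _ (kArg_pos hτ hκ)
          _ = _ := by ring
    rw [integral_const_mul] at h
    linarith
  have hDx := hD τ hτ hτ' x
  have he := Real.exp_pos (x^2 / 2)
  rw [E1mK, kExp]
  calc _ ≤ Mb * J * Real.exp (x^2 / 2) / (d / τ) :=
        div_le_div₀ (by positivity) hN (by positivity) hDx
    _ = Mb * J / d * τ * Real.exp (x^2 / 2) := by field_simp
    _ ≤ (Mb * J + 1) / d * τ * Real.exp (x^2 / 2) := by gcongr; linarith

/-- Lower bound on the posterior shrinkage weight: the spike at `1` loses against the slab as soon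
as `exp (x² / 2)` dominates `τ⁻¹`. -/
lemma exists_le_E1mK {L : ℝ → ℝ} {Mb c0 t0 : ℝ} (hL : AssumpL L Mb c0 t0)
    (hint : IntegrableOn (fun t => t ^ (-(1/2 : ℝ) - 1) * L t) (Ioi 0)) {δ : ℝ} (hδ : 0 < δ)
    (hδ' : δ ≤ 1/8) :
    ∃ A : ℝ, 0 < A ∧ ∀ τ x : ℝ, 0 < τ → t0 * τ^2 ≤ 1 →
      3/4 - A * Real.exp (-x^2 / 16) - A * τ⁻¹ * Real.exp (-(1 - 2 * δ) * x^2 / 2) ≤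
        E1mK (1/2) L x τ := by
  obtain ⟨hm, hpos, hM, hc0, ht0, hc⟩ := hL
  have hMb : 0 < Mb := (hpos 1 one_pos).trans_le (hM 1 one_pos)
  set I := ∫ t in Ioi (0 : ℝ), t ^ (-(1/2 : ℝ) - 1) * L t with hI
  have hI0 : 0 ≤ I := setIntegral_nonneg measurableSet_Ioi fun t ht =>
    mul_nonneg (Real.rpow_nonneg (le_of_lt ht) _) (hpos t ht).le
  set m := δ ^ (-(1/2 : ℝ) - 1) * Mb with hmdef
  have hm0 : 0 < m := by positivity
  set d := δ / 2 * c0 with hd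
  have hd0 : 0 < d := by positivity
  refine ⟨(m + I) / d, by positivity, fun τ x hτ hτ' => ?_⟩
  have hkint := integrableOn_kdens_half hm hpos hint hτ x
  obtain ⟨hbint, hbase⟩ := kBase_integrableOn_and_integral_le hm hpos hint hτ
  rw [← hI] at hbase
  set D := ∫ κ in Ioo (0 : ℝ) 1, kdens (1/2) L x τ κ with hDdef
  have hDlow : d * Real.exp ((1 - δ) * x^2 / 2) ≤ D := by
    have hlow : ∀ κ ∈ Icc (δ / 2) δ, c0 * Real.exp ((1 - δ) * x^2 / 2) ≤ kdens (1/2) L x τ κ := by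
      intro κ hκ
      have hκ0 : 0 < κ := lt_of_lt_of_le (by positivity) hκ.1
      have hκ1 : κ < 1 := by linarith [hκ.2]
      have harg : t0 ≤ (1/τ^2) * (1/κ - 1) := by
        have h1 : 2 ≤ 1 / κ := by
          rw [le_div_iff₀ hκ0]
          linarith [hκ.2]
        calc t0 ≤ 1/τ^2 * 1 := by rw [mul_one, le_div_iff₀ (by positivity)]; exact hτ'
          _ ≤ (1/τ^2) * (1/κ - 1) := by gcongr; linarith
      have hpow : 1 ≤ (1 - κ) ^ (-(1/2 : ℝ) - 1) :=
        Real.one_le_rpow_of_pos_of_le_one_of_nonpos (by linarith) (by linarith) (by norm_num)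
      have hb : c0 ≤ kBase L τ κ := by
        have := mul_le_mul hpow (hc _ harg) hc0.le (zero_le_one.trans hpow)
        rwa [one_mul] at this
      rw [kdens_half]
      exact mul_le_mul hb (by gcongr; exact hκ.2) (Real.exp_pos _).le
        (kBase_pos hpos hτ ⟨hκ0, hκ1⟩).le
    have := mul_sub_le_setIntegral_Ioo hkint (fun κ hκ => (kdens_half_pos hpos hτ hκ).le)
      (by positivity) (by linarith) (by linarith) hlow
    calc d * Real.exp ((1 - δ) * x^2 / 2)
        = (δ - δ / 2) * (c0 * Real.exp ((1 - δ) * x^2 / 2)) := by rw [hd]; ring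
      _ ≤ D := this
  have hDpos : 0 < D := lt_of_lt_of_le (by positivity) hDlow
  have hκint : IntegrableOn (fun κ => κ * kdens (1/2) L x τ κ) (Ioo 0 1) := by
    refine Integrable.mono hkint (measurable_id.aestronglyMeasurable.mul
      hkint.aestronglyMeasurable) ?_
    filter_upwards [ae_restrict_mem measurableSet_Ioo] with κ hκ
    rw [norm_mul, Real.norm_of_nonneg hκ.1.le]
    exact mul_le_of_le_one_left (norm_nonneg _) hκ.2.le
  have hN : ∫ κ in Ioo (0 : ℝ) 1, κ * kdens (1/2) L x τ κ ≤
      D / 4 + m * Real.exp (3 / 4 * x^2 / 2) + Real.exp (δ * x^2 / 2) * (τ⁻¹ * I) := by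
    have hpt : ∀ κ ∈ Ioo (0 : ℝ) 1, κ * kdens (1/2) L x τ κ ≤
        1/4 * kdens (1/2) L x τ κ + m * Real.exp (3 / 4 * x^2 / 2) +
          Real.exp (δ * x^2 / 2) * kBase L τ κ := by
      intro κ hκ
      have hk := kdens_half_pos hpos (x := x) hτ hκ
      have hb := kBase_pos hpos hτ hκ
      have he1 : 0 < m * Real.exp (3 / 4 * x^2 / 2) := by positivity
      have he2 : 0 < Real.exp (δ * x^2 / 2) * kBase L τ κ := by positivity
      rcases le_or_gt κ (1/4) with h | h
      · nlinarith [mul_le_mul_of_nonneg_right h hk.le]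
      have hκk : κ * kdens (1/2) L x τ κ ≤ kdens (1/2) L x τ κ :=
        mul_le_of_le_one_left hk.le hκ.2.le
      rcases le_or_gt (1 - κ) δ with h' | h'
      · have : kdens (1/2) L x τ κ ≤ Real.exp (δ * x^2 / 2) * kBase L τ κ := by
          rw [kdens_half, mul_comm]
          exact mul_le_mul_of_nonneg_right (tilt_le h') hb.le
        linarith
      · have : kdens (1/2) L x τ κ ≤ m * Real.exp (3 / 4 * x^2 / 2) := by
          rw [kdens_half]
          refine mul_le_mul ?_ (tilt_le (by linarith)) (Real.exp_pos _).le hm0.le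
          exact mul_le_mul (Real.rpow_le_rpow_of_nonpos hδ h'.le (by norm_num))
            (hM _ (kArg_pos hτ hκ)) (hpos _ (kArg_pos hτ hκ)).le (Real.rpow_nonneg hδ.le _)
        linarith
    have hc' : IntegrableOn (fun _ : ℝ => m * Real.exp (3 / 4 * x^2 / 2)) (Ioo 0 1) :=
      integrableOn_const (by simp)
    have h1 := hkint.const_mul (1/4)
    have h2 := hbint.const_mul (Real.exp (δ * x^2 / 2))
    have h12 : IntegrableOn (fun κ => 1/4 * kdens (1/2) L x τ κ +
        m * Real.exp (3 / 4 * x^2 / 2)) (Ioo 0 1) := h1.add hc'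
    calc _ ≤ ∫ κ in Ioo (0 : ℝ) 1, (1/4 * kdens (1/2) L x τ κ + m * Real.exp (3 / 4 * x^2 / 2) +
          Real.exp (δ * x^2 / 2) * kBase L τ κ) :=
          setIntegral_mono_on hκint (h12.add h2) measurableSet_Ioo hpt
      _ = 1/4 * D + m * Real.exp (3 / 4 * x^2 / 2) +
          Real.exp (δ * x^2 / 2) * ∫ κ in Ioo (0 : ℝ) 1, kBase L τ κ := by
          rw [integral_add h12 h2, integral_add h1 hc', integral_const_mul (1/4),
            integral_const_mul (Real.exp (δ * x^2 / 2)), ← hDdef]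
          simp [Measure.real]
      _ ≤ _ := by
          have := mul_le_mul_of_nonneg_left hbase (Real.exp_pos (δ * x^2 / 2)).le
          linarith
  have hE : E1mK (1/2) L x τ = 1 - (∫ κ in Ioo (0 : ℝ) 1, κ * kdens (1/2) L x τ κ) / D := by
    rw [E1mK, kExp, ← hDdef, eq_sub_iff_add_eq, ← add_div, div_eq_one_iff_eq hDpos.ne', hDdef]
    simp only [sub_mul, one_mul]
    rw [integral_sub hkint hκint]
    ring
  have hτi : 0 < τ⁻¹ := inv_pos.2 hτ
  have ht1 : m * Real.exp (3 / 4 * x^2 / 2) / D ≤ (m + I) / d * Real.exp (-x^2 / 16) := by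
    calc _ ≤ m * Real.exp (3 / 4 * x^2 / 2) / (d * Real.exp ((1 - δ) * x^2 / 2)) := by gcongr
      _ = m / d * Real.exp (3 / 4 * x^2 / 2 - (1 - δ) * x^2 / 2) := by
          rw [Real.exp_sub]
          field_simp
      _ ≤ _ := by
          gcongr
          · linarith
          · nlinarith [sq_nonneg x]
  have ht2 : Real.exp (δ * x^2 / 2) * (τ⁻¹ * I) / D ≤
      (m + I) / d * τ⁻¹ * Real.exp (-(1 - 2 * δ) * x^2 / 2) := by
    calc _ ≤ Real.exp (δ * x^2 / 2) * (τ⁻¹ * I) / (d * Real.exp ((1 - δ) * x^2 / 2)) := by gcongr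
      _ = I / d * τ⁻¹ * Real.exp (δ * x^2 / 2 - (1 - δ) * x^2 / 2) := by
          rw [Real.exp_sub]
          field_simp
      _ ≤ _ := by
          have : δ * x^2 / 2 - (1 - δ) * x^2 / 2 = -(1 - 2 * δ) * x^2 / 2 := by ring
          rw [this]
          gcongr
          linarith
  have hfin : (∫ κ in Ioo (0 : ℝ) 1, κ * kdens (1/2) L x τ κ) / D ≤
      1/4 + (m + I) / d * Real.exp (-x^2 / 16) +
        (m + I) / d * τ⁻¹ * Real.exp (-(1 - 2 * δ) * x^2 / 2) := by
    calc _ ≤ (D / 4 + m * Real.exp (3 / 4 * x^2 / 2) +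
          Real.exp (δ * x^2 / 2) * (τ⁻¹ * I)) / D := by gcongr
      _ = 1/4 + m * Real.exp (3 / 4 * x^2 / 2) / D +
          Real.exp (δ * x^2 / 2) * (τ⁻¹ * I) / D := by field_simp
      _ ≤ _ := by linarith
  rw [hE]
  linarith

lemma E1mK_mem_Icc {L : ℝ → ℝ} (hL : Measurable L) (hpos : ∀ t, 0 < t → 0 < L t)
    (hint : IntegrableOn (fun t => t ^ (-(1/2 : ℝ) - 1) * L t) (Ioi 0)) {τ : ℝ} (hτ : 0 < τ)
    (x : ℝ) : E1mK (1/2) L x τ ∈ Icc (0 : ℝ) 1 := by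
  have hnum : ∀ κ ∈ Ioo (0 : ℝ) 1, 0 ≤ (1 - κ) * kdens (1/2) L x τ κ := fun κ hκ =>
    mul_nonneg (by linarith [hκ.2]) (kdens_half_pos hpos hτ hκ).le
  have hden : 0 ≤ ∫ κ in Ioo (0 : ℝ) 1, kdens (1/2) L x τ κ :=
    setIntegral_nonneg measurableSet_Ioo fun κ hκ => (kdens_half_pos hpos hτ hκ).le
  refine ⟨div_nonneg (setIntegral_nonneg measurableSet_Ioo hnum) hden,
    div_le_one_of_le₀ ?_ hden⟩
  refine integral_mono_of_nonneg ((ae_restrict_mem measurableSet_Ioo).mono hnum)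
    (integrableOn_kdens_half hL hpos hint hτ x) ?_
  filter_upwards [ae_restrict_mem measurableSet_Ioo] with κ hκ
  exact mul_le_of_le_one_left (kdens_half_pos hpos hτ hκ).le (by linarith [hκ.1])

lemma measurable_E1mK {L : ℝ → ℝ} (hL : Measurable L) (x : ℝ) :
    Measurable fun τ => E1mK (1/2) L x τ := by
  have hk := measurable_kdens_uncurry hL x
  have hnum : Measurable fun q : ℝ × ℝ => (1 - q.2) * kdens (1/2) L x q.1 q.2 :=
    (measurable_const.sub measurable_snd).mul hk
  exact (hnum.stronglyMeasurable.integral_prod_right' (ν := volume.restrict (Ioo 0 1))).measurable.div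
    (hk.stronglyMeasurable.integral_prod_right' (ν := volume.restrict (Ioo 0 1))).measurable

/-- The `N(0, 1 + l τ²)` density at `x`. -/
def slabDens (x τ l : ℝ) : ℝ :=
  (Real.sqrt (2 * Real.pi * (1 + l * τ^2)))⁻¹ * Real.exp (-(x^2) / (2 * (1 + l * τ^2)))

lemma slabDens_pos (x τ : ℝ) {l : ℝ} (hl : 0 < l) : 0 < slabDens x τ l := by
  unfold slabDens
  positivity

lemma slabDens_le_one (x τ : ℝ) {l : ℝ} (hl : 0 < l) : slabDens x τ l ≤ 1 := by
  have h0 : 0 ≤ l * τ^2 := by positivity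
  have h1 : 1 ≤ √(2 * Real.pi * (1 + l * τ^2)) := by
    refine Real.le_sqrt_of_sq_le ?_
    nlinarith [Real.pi_gt_three]
  refine mul_le_one₀ (inv_le_one_of_one_le₀ h1) (Real.exp_pos _).le (Real.exp_le_one_iff.2 ?_)
  exact div_nonpos_of_nonpos_of_nonneg (by linarith [sq_nonneg x]) (by linarith)

section Marginal

variable {a K Mb c0 t0 : ℝ} {L : ℝ → ℝ}

lemma Kcond.pos (hK : Kcond a L K) : 0 < K := by
  rw [hK.2.2]
  exact inv_pos.2 hK.2.1

lemma measurable_marg (hL : Measurable L) (x : ℝ) : Measurable fun τ => marg a K L x τ := by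
  have : Measurable fun q : ℝ × ℝ => K * q.2 ^ (-a-1) * L q.2 * slabDens x q.1 q.2 := by
    unfold slabDens
    fun_prop
  exact (this.stronglyMeasurable.integral_prod_right' (ν := volume.restrict (Ioi 0))).measurable

lemma marg_mem_Ioc (hL : AssumpL L Mb c0 t0) (hK : Kcond a L K) (x τ : ℝ) :
    marg a K L x τ ∈ Ioc (0 : ℝ) 1 := by
  have hKpos := hK.pos
  obtain ⟨hint, hI, hKeq⟩ := hK
  have hprior : ∀ l ∈ Ioi (0 : ℝ), 0 < K * l ^ (-a-1) * L l := fun l hl =>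
    mul_pos (mul_pos hKpos (Real.rpow_pos_of_pos hl _)) (hL.2.1 l hl)
  have hpint : IntegrableOn (fun l => K * l ^ (-a-1) * L l) (Ioi 0) := by
    have h : IntegrableOn (fun l => K * (l ^ (-a-1) * L l)) (Ioi 0) := hint.const_mul K
    simpa only [mul_assoc] using h
  have hfpos : ∀ l ∈ Ioi (0 : ℝ), 0 < K * l ^ (-a-1) * L l * slabDens x τ l := fun l hl =>
    mul_pos (hprior l hl) (slabDens_pos x τ hl)
  have hfle : ∀ l ∈ Ioi (0 : ℝ), K * l ^ (-a-1) * L l * slabDens x τ l ≤ K * l ^ (-a-1) * L l :=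
    fun l hl => mul_le_of_le_one_right (hprior l hl).le (slabDens_le_one x τ hl)
  have hfmeas : Measurable fun l => K * l ^ (-a-1) * L l * slabDens x τ l := by
    have := hL.1
    unfold slabDens
    fun_prop
  have hfint : IntegrableOn (fun l => K * l ^ (-a-1) * L l * slabDens x τ l) (Ioi 0) := by
    refine Integrable.mono' hpint hfmeas.aestronglyMeasurable ?_
    filter_upwards [ae_restrict_mem measurableSet_Ioi] with l hl
    rw [Real.norm_of_nonneg (hfpos l hl).le]
    exact hfle l hl
  constructor
  · change 0 < ∫ l in Ioi (0 : ℝ), K * l ^ (-a-1) * L l * slabDens x τ l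
    rw [setIntegral_pos_iff_support_of_nonneg_ae
      ((ae_restrict_mem measurableSet_Ioi).mono fun l hl => (hfpos l hl).le) hfint]
    refine lt_of_lt_of_le ?_ (measure_mono fun l (hl : l ∈ Ioi (0 : ℝ)) =>
      ⟨(hfpos l hl).ne', hl⟩)
    simp
  · calc marg a K L x τ ≤ ∫ l in Ioi (0 : ℝ), K * l ^ (-a-1) * L l :=
          setIntegral_mono_on hfint hpint measurableSet_Ioi hfle
      _ = 1 := by
          simp only [mul_assoc]
          rw [integral_const_mul, hKeq, inv_mul_cancel₀ hI.ne']

lemma integrableOn_mul_prod_marg (hL : AssumpL L Mb c0 t0) (hK : Kcond a L K) {π2 : ℝ → ℝ}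
    {lo hi : ℝ} (hint : IntegrableOn π2 (Icc lo hi)) {n : ℕ} (X : Fin n → ℝ) :
    IntegrableOn (fun τ => π2 τ * ∏ i, marg a K L (X i) τ) (Icc lo hi) := by
  have hmeas : Measurable fun τ => ∏ i, marg a K L (X i) τ :=
    Finset.measurable_fun_prod _ fun i _ => measurable_marg hL.1 (X i)
  refine Integrable.mono hint (hint.aestronglyMeasurable.mul hmeas.aestronglyMeasurable) ?_
  refine ae_of_all _ fun τ => ?_
  rw [norm_mul]
  refine mul_le_of_le_one_right (norm_nonneg _) ?_
  rw [Real.norm_of_nonneg (Finset.prod_nonneg fun i _ => (marg_mem_Ioc hL hK (X i) τ).1.le)]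
  exact Finset.prod_le_one (fun i _ => (marg_mem_Ioc hL hK (X i) τ).1.le)
    fun i _ => (marg_mem_Ioc hL hK (X i) τ).2

lemma integral_mul_prod_marg_pos (hL : AssumpL L Mb c0 t0) (hK : Kcond a L K) {π2 : ℝ → ℝ}
    {lo hi : ℝ} (h0 : ∀ τ, 0 ≤ π2 τ) (hone : ∫ τ in Icc lo hi, π2 τ = 1) {n : ℕ}
    (X : Fin n → ℝ) :
    0 < ∫ τ in Icc lo hi, π2 τ * ∏ i, marg a K L (X i) τ := by
  have hint : IntegrableOn π2 (Icc lo hi) := by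
    by_contra h
    rw [integral_undef h] at hone
    exact zero_ne_one hone
  have hprod : ∀ τ, 0 < ∏ i, marg a K L (X i) τ := fun τ =>
    Finset.prod_pos fun i _ => (marg_mem_Ioc hL hK (X i) τ).1
  have hπ : 0 < ∫ τ in Icc lo hi, π2 τ := by rw [hone]; exact one_pos
  rw [integral_pos_iff_support_of_nonneg (fun τ => mul_nonneg (h0 τ) (hprod τ).le)
    (integrableOn_mul_prod_marg hL hK hint X)]
  rw [integral_pos_iff_support_of_nonneg h0 hint] at hπ
  convert hπ using 2
  ext τ
  simp [(hprod τ).ne']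

/-- The full Bayes shrinkage weight inherits bounds on `E(1−κ | x, τ)` that are uniform in `τ`. -/
lemma fbShrink_mem_Icc (hL : AssumpL L Mb c0 t0) (hK : Kcond (1/2) L K) {π2 : ℝ → ℝ}
    {lo hi : ℝ} (hlo : 0 < lo) (h0 : ∀ τ, 0 ≤ π2 τ) (hone : ∫ τ in Icc lo hi, π2 τ = 1) {n : ℕ}
    (X : Fin n → ℝ) (i : Fin n) {b₁ b₂ : ℝ}
    (hb : ∀ τ ∈ Icc lo hi, E1mK (1/2) L (X i) τ ∈ Icc b₁ b₂) :
    fbShrink (1/2) K L π2 lo hi n X i ∈ Icc b₁ b₂ := by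
  have hint : IntegrableOn π2 (Icc lo hi) := by
    by_contra h
    rw [integral_undef h] at hone
    exact zero_ne_one hone
  set w : ℝ → ℝ := fun τ => π2 τ * ∏ j, marg (1/2) K L (X j) τ with hw
  have hwint : IntegrableOn w (Icc lo hi) := integrableOn_mul_prod_marg hL hK hint X
  have hw0 : ∀ τ, 0 ≤ w τ := fun τ =>
    mul_nonneg (h0 τ) (Finset.prod_nonneg fun j _ => (marg_mem_Ioc hL hK (X j) τ).1.le)
  have hZ : 0 < ∫ τ in Icc lo hi, w τ := integral_mul_prod_marg_pos hL hK h0 hone X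
  have hfb : fbShrink (1/2) K L π2 lo hi n X i =
      (∫ τ in Icc lo hi, E1mK (1/2) L (X i) τ * w τ) / ∫ τ in Icc lo hi, w τ := by
    rw [← integral_div]
    simp only [fbShrink, tauWeight, hw, mul_div_assoc]
  have hEint : IntegrableOn (fun τ => E1mK (1/2) L (X i) τ * w τ) (Icc lo hi) := by
    refine Integrable.mono hwint ((measurable_E1mK hL.1 (X i)).aestronglyMeasurable.mul
      hwint.aestronglyMeasurable) ?_
    filter_upwards [ae_restrict_mem measurableSet_Icc] with τ hτ
    have hE := E1mK_mem_Icc hL.1 hL.2.1 hK.1 (hlo.trans_le hτ.1) (X i)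
    rw [norm_mul, Real.norm_of_nonneg hE.1]
    exact mul_le_of_le_one_left (norm_nonneg _) hE.2
  rw [hfb, mem_Icc, le_div_iff₀ hZ, div_le_iff₀ hZ, ← integral_const_mul, ← integral_const_mul]
  exact ⟨setIntegral_mono_on (hwint.const_mul _) hEint measurableSet_Icc fun τ hτ =>
      mul_le_mul_of_nonneg_right (hb τ hτ).1 (hw0 τ),
    setIntegral_mono_on hEint (hwint.const_mul _) measurableSet_Icc fun τ hτ =>
      mul_le_mul_of_nonneg_right (hb τ hτ).2 (hw0 τ)⟩

end Marginal

section Errors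

variable {a K : ℝ} {L : ℝ → ℝ} {π2 : ℕ → ℝ → ℝ} {α p u : ℕ → ℝ} {n : ℕ} {i : Fin n} {s : ℝ}

lemma nullMeas_preimage (hp : 0 ≤ p n ∧ p n ≤ 1) {S : Set ℝ} (hS : MeasurableSet S) :
    nullMeas n i (p n) (u n) {x | x i ∈ S} = gaussianReal 0 1 S := by
  have := isProbabilityMeasure_mixM (u := u n) hp.1 hp.2
  exact pi_update_preimage_eval i _ _ hS

lemma altMeas_preimage (hp : 0 ≤ p n ∧ p n ≤ 1) {S : Set ℝ} (hS : MeasurableSet S) :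
    altMeas n i (p n) (u n) {x | x i ∈ S} = gaussianReal 0 (1 + u n).toNNReal S := by
  have := isProbabilityMeasure_mixM (u := u n) hp.1 hp.2
  exact pi_update_preimage_eval i _ _ hS

instance (n : ℕ) (i : Fin n) (p u : ℝ) [IsProbabilityMeasure (mixM p u)] :
    IsProbabilityMeasure (altMeas n i p u) := by
  have : ∀ j, IsProbabilityMeasure
      (if j = i then gaussianReal 0 (Real.toNNReal (1 + u)) else mixM p u) := fun j => by
    split_ifs <;> infer_instance
  unfold altMeas
  infer_instance

lemma t1FB_le (hp : 0 ≤ p n ∧ p n ≤ 1)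
    (h : ∀ X : Fin n → ℝ, X i ^ 2 ≤ s → fbShrink a K L (π2 n) ((n:ℝ)⁻¹) (α n) n X i ≤ 1/2) :
    t1FB a K L π2 α p u n i ≤ (gaussianReal 0 1).real {z | s < z ^ 2} := by
  rw [measureReal_def, ← nullMeas_preimage (i := i) (u := u) hp (measurableSet_lt_sq s)]
  refine ENNReal.toReal_mono ?_ (measure_mono fun X hX => ?_)
  · rw [nullMeas_preimage hp (measurableSet_lt_sq s)]
    exact measure_ne_top _ _
  · by_contra hXs
    exact absurd (h X (not_lt.1 hXs)) (not_le.2 hX)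

lemma le_t2FB (hp : 0 ≤ p n ∧ p n ≤ 1) (hu : 0 < u n)
    (h : ∀ X : Fin n → ℝ, X i ^ 2 ≤ s → fbShrink a K L (π2 n) ((n:ℝ)⁻¹) (α n) n X i ≤ 1/2) :
    gaussSqCdf (s / (1 + u n)) ≤ t2FB a K L π2 α p u n i := by
  have := isProbabilityMeasure_mixM (u := u n) hp.1 hp.2
  rw [← gaussianReal_zero_sq_le (by linarith) s, measureReal_def,
    ← altMeas_preimage (i := i) hp (measurableSet_sq_le s)]
  exact ENNReal.toReal_mono (measure_ne_top _ _) (measure_mono fun X hX => h X hX)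

lemma t2FB_le (hp : 0 ≤ p n ∧ p n ≤ 1) (hu : 0 < u n)
    (h : ∀ X : Fin n → ℝ, s < X i ^ 2 → 1/2 < fbShrink a K L (π2 n) ((n:ℝ)⁻¹) (α n) n X i) :
    t2FB a K L π2 α p u n i ≤ gaussSqCdf (s / (1 + u n)) := by
  rw [← gaussianReal_zero_sq_le (by linarith) s, measureReal_def,
    ← altMeas_preimage (i := i) hp (measurableSet_sq_le s)]
  refine ENNReal.toReal_mono ?_ (measure_mono fun X hX => ?_)
  · rw [altMeas_preimage hp (measurableSet_sq_le s)]
    exact measure_ne_top _ _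
  · by_contra hXs
    exact absurd (h X (not_le.1 hXs)) (not_lt.2 hX)

end Errors

section Asymptotics

variable {p u cs α : ℕ → ℝ} {C : ℝ}

lemma propToR.eventually_pos (hpe : propToR p (-1)) :
    ∃ k₁ k₂ : ℝ, 0 < k₁ ∧ 0 < k₂ ∧
      ∀ᶠ n : ℕ in atTop, 0 < p n ∧ k₁ ≤ p n * n ∧ p n * n ≤ k₂ := by
  obtain ⟨k₁, k₂, h₁, h₂, h⟩ := hpe
  refine ⟨k₁, k₂, h₁, h₂, ?_⟩
  filter_upwards [h, eventually_gt_atTop 0] with n hn hn0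
  have hn0' : (0 : ℝ) < n := Nat.cast_pos.2 hn0
  rw [Real.rpow_neg_one, ← div_eq_mul_inv, ← div_eq_mul_inv, div_le_iff₀ hn0',
    le_div_iff₀ hn0'] at hn
  exact ⟨pos_of_mul_pos_left (h₁.trans_le hn.1) hn0'.le, hn⟩

lemma tendsto_log_natCast : Tendsto (fun n : ℕ => Real.log n) atTop atTop :=
  Real.tendsto_log_atTop.comp tendsto_natCast_atTop_atTop

lemma tendsto_log_div_self (hu : Tendsto u atTop atTop) :
    Tendsto (fun n => Real.log (u n) / u n) atTop (nhds 0) :=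
  Real.isLittleO_log_id_atTop.tendsto_div_nhds_zero.comp hu

lemma tendsto_div_one_add (hu : Tendsto u atTop atTop) :
    Tendsto (fun n => u n / (1 + u n)) atTop (nhds 1) := by
  have h : Tendsto (fun n => 1 - 1 / (1 + u n)) atTop (nhds (1 - 0)) :=
    tendsto_const_nhds.sub
      (tendsto_const_nhds.div_atTop (tendsto_const_nhds.add_atTop hu))
  rw [sub_zero] at h
  refine h.congr' ?_
  filter_upwards [hu.eventually_gt_atTop 0] with n hn
  field_simp
  ring

lemma tendsto_log_one_add_div (hu : Tendsto u atTop atTop) :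
    Tendsto (fun n => Real.log (1 + u n) / u n) atTop (nhds 0) := by
  have h := (tendsto_log_div_self (u := fun n => 1 + u n) (tendsto_const_nhds.add_atTop hu)).div
    (tendsto_div_one_add hu) one_ne_zero
  rw [zero_div] at h
  refine h.congr' ?_
  filter_upwards [hu.eventually_gt_atTop 0] with n hn
  simp only [Pi.div_apply]
  field_simp

lemma Assump2.tendsto_log_odds_div (hA : Assump2 p u C) (hp : ∀ᶠ n in atTop, 0 < p n) :
    Tendsto (fun n => 2 * Real.log ((1 - p n) / p n) / u n) atTop (nhds C) := by
  obtain ⟨hp0, hu, -, hC⟩ := hA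
  have h := hC.sub (tendsto_log_div_self hu)
  rw [sub_zero] at h
  refine h.congr' ?_
  filter_upwards [hu.eventually_gt_atTop 0, hp, hp0.eventually_lt_const one_pos] with n hn h0 h1
  have hf : 0 < (1 - p n) / p n := div_pos (by linarith) h0
  rw [Real.log_mul hn.ne' (by positivity), Real.log_pow]
  push_cast
  ring

lemma Assump2.tendsto_csq_div (hA : Assump2 p u C) (hp : ∀ᶠ n in atTop, 0 < p n) :
    Tendsto (fun n => csq p u n / (1 + u n)) atTop (nhds C) := by
  have h := (tendsto_log_one_add_div hA.2.1).add (hA.tendsto_log_odds_div hp)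
  rw [zero_add] at h
  refine h.congr' ?_
  filter_upwards [hA.2.1.eventually_gt_atTop 0] with n hn
  unfold csq
  field_simp

lemma Assump2.tendsto_log_div (hA : Assump2 p u C) (hpe : propToR p (-1)) :
    Tendsto (fun n : ℕ => 2 * Real.log n / (1 + u n)) atTop (nhds C) := by
  obtain ⟨k₁, k₂, h₁, h₂, hk⟩ := hpe.eventually_pos
  have hodds := hA.tendsto_log_odds_div (hk.mono fun n h => h.1)
  obtain ⟨hp0, hu, -, -⟩ := hA
  have hq : Tendsto (fun n => Real.log (1 - p n) / u n) atTop (nhds 0) := by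
    have h1 : Tendsto (fun n => Real.log (1 - p n)) atTop (nhds 0) := by
      have := (tendsto_const_nhds (x := (1 : ℝ))).sub hp0
      rw [sub_zero] at this
      simpa using this.log one_ne_zero
    exact h1.div_atTop hu
  have hr : Tendsto (fun n : ℕ => Real.log (p n * n) / u n) atTop (nhds 0) := by
    refine tendsto_of_tendsto_of_tendsto_of_le_of_le'
      ((tendsto_const_nhds (x := Real.log k₁)).div_atTop hu)
      ((tendsto_const_nhds (x := Real.log k₂)).div_atTop hu) ?_ ?_
    · filter_upwards [hk, hu.eventually_gt_atTop 0] with n hn hun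
      exact div_le_div_of_nonneg_right (Real.log_le_log h₁ hn.2.1) hun.le
    · filter_upwards [hk, hu.eventually_gt_atTop 0] with n hn hun
      exact div_le_div_of_nonneg_right (Real.log_le_log (h₁.trans_le hn.2.1) hn.2.2) hun.le
  have h := ((hodds.add ((hr.sub hq).const_mul 2))).mul (tendsto_div_one_add hu)
  rw [sub_zero, mul_zero, add_zero, mul_one] at h
  refine h.congr' ?_
  filter_upwards [hk, hu.eventually_gt_atTop 0, hp0.eventually_lt_const one_pos,
    eventually_gt_atTop 0] with n hn hun h1 hn0
  have hn0' : (n : ℝ) ≠ 0 := Nat.cast_ne_zero.2 hn0.ne'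
  rw [Real.log_div (by linarith) hn.1.ne', Real.log_mul hn.1.ne' hn0']
  field_simp
  ring

/-- The condition on `α_n` forces `log (1/α_n) ∼ log n`. -/
lemma tendsto_log_one_div_div_log
    (hcso : Tendsto (fun n : ℕ => cs n / Real.log (Real.log n)) atTop (nhds 0))
    (hα : ∀ᶠ n : ℕ in atTop,
      Real.log (1/(α n)) = Real.log n - (1/2) * Real.log (Real.log n) + cs n) (b : ℝ) :
    Tendsto (fun n : ℕ => (Real.log (1/(α n)) - b) / Real.log n) atTop (nhds 1) := by
  have hl := tendsto_log_div_self tendsto_log_natCast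
  have hll := Real.tendsto_log_atTop.comp tendsto_log_natCast
  have h := ((hcso.sub_const (1/2)).mul hl).sub
    ((tendsto_const_nhds (x := b)).div_atTop tendsto_log_natCast)
  have h := h.const_add 1
  rw [mul_zero, sub_zero, add_zero] at h
  refine h.congr' ?_
  filter_upwards [hα, tendsto_log_natCast.eventually_gt_atTop 0, hll.eventually_gt_atTop 0]
    with n hn h1 h2
  simp only [Function.comp_apply] at h2
  rw [hn]
  field_simp
  ring

end Asymptotics

section Risk

variable {p u cs α : ℕ → ℝ} {π2 : ℕ → ℝ → ℝ} {L : ℝ → ℝ} {C K Mb c0 t0 : ℝ}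

lemma CondC3.eventually_pos (hC3 : CondC3 π2 α) : ∀ᶠ n : ℕ in atTop, 0 < α n := by
  filter_upwards [hC3.2.2.2.2.eventually_gt_atTop 0] with n hn
  exact pos_of_mul_pos_right hn (Nat.cast_nonneg n)

lemma CondC3.eventually_mul_sq_le (hC3 : CondC3 π2 α) (ht0 : 0 < t0) :
    ∀ᶠ n : ℕ in atTop, ∀ τ ∈ Icc ((n : ℝ)⁻¹) (α n), 0 < τ ∧ t0 * τ ^ 2 ≤ 1 := by
  have h : Tendsto (fun n => t0 * α n ^ 2) atTop (nhds 0) := by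
    simpa using (hC3.2.2.2.1.pow 2).const_mul t0
  filter_upwards [h.eventually_lt_const one_pos, eventually_gt_atTop 0] with n hn hn0 τ hτ
  have hτ0 : 0 < τ := (inv_pos.2 (Nat.cast_pos.2 hn0)).trans_le hτ.1
  refine ⟨hτ0, le_trans ?_ hn.le⟩
  have := hτ.2
  gcongr

/-- Small observations are not rejected by the full Bayes rule. -/
lemma exists_fbShrink_le_half (hL : AssumpL L Mb c0 t0) (hK : Kcond (1/2) L K)
    (hC3 : CondC3 π2 α) :
    ∃ B : ℝ, 0 < B ∧ ∀ᶠ n : ℕ in atTop, ∀ (X : Fin n → ℝ) (i : Fin n),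
      X i ^ 2 ≤ 2 * (Real.log (1 / α n) - Real.log (2 * B)) →
        fbShrink (1/2) K L (π2 n) ((n:ℝ)⁻¹) (α n) n X i ≤ 1/2 := by
  obtain ⟨B, hB, hE⟩ := exists_E1mK_le hL hK.1
  refine ⟨B, hB, ?_⟩
  filter_upwards [hC3.eventually_pos, hC3.eventually_mul_sq_le hL.2.2.2.2.1, eventually_gt_atTop 0]
    with n hα hτ hn X i hX
  refine (fbShrink_mem_Icc hL hK (b₁ := 0) (inv_pos.2 (Nat.cast_pos.2 hn)) (hC3.1 n)
    (hC3.2.2.1 n hn) X i fun τ h => ?_).2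
  refine ⟨(E1mK_mem_Icc hL.1 hL.2.1 hK.1 (hτ τ h).1 (X i)).1, ?_⟩
  calc E1mK (1/2) L (X i) τ ≤ B * τ * Real.exp (X i ^ 2 / 2) :=
        hE τ (X i) (hτ τ h).1 (hτ τ h).2
    _ ≤ B * α n * Real.exp (Real.log (1 / α n) - Real.log (2 * B)) := by
        have := h.2
        gcongr
        linarith
    _ = 1/2 := by
        rw [Real.exp_sub, Real.exp_log (by positivity), Real.exp_log (by positivity)]
        field_simp

/-- Large observations are rejected by the full Bayes rule. -/
lemma eventually_half_lt_fbShrink (hL : AssumpL L Mb c0 t0) (hK : Kcond (1/2) L K)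
    (hC3 : CondC3 π2 α) {ε : ℝ} (hε : 0 < ε) (hε' : ε ≤ 1/2) :
    ∀ᶠ n : ℕ in atTop, ∀ (X : Fin n → ℝ) (i : Fin n),
      2 * (1 + ε) * Real.log n < X i ^ 2 →
        1/2 < fbShrink (1/2) K L (π2 n) ((n:ℝ)⁻¹) (α n) n X i := by
  obtain ⟨δ, hδ, hδ8, hδε⟩ :
      ∃ δ : ℝ, 0 < δ ∧ δ ≤ 1/8 ∧ (1 - 2 * δ) * (1 + ε) = 1 + ε / 2 := by
    refine ⟨ε / (4 * (1 + ε)), by positivity, ?_, ?_⟩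
    · rw [div_le_iff₀ (by positivity)]
      linarith
    · field_simp
      ring
  obtain ⟨A, hA, hE⟩ := exists_le_E1mK hL hK.1 hδ hδ8
  have hδ' : 0 < 1 - 2 * δ := by linarith
  have hsmall : ∀ c : ℝ, 0 < c →
      ∀ᶠ n : ℕ in atTop, A * Real.exp (-(c * Real.log n)) < 1/16 := fun c hc => by
    have h := (Real.tendsto_exp_neg_atTop_nhds_zero.comp
      (tendsto_log_natCast.const_mul_atTop hc)).const_mul A
    rw [mul_zero] at h
    exact h.eventually_lt_const (by norm_num)
  filter_upwards [hC3.eventually_mul_sq_le hL.2.2.2.2.1, eventually_gt_atTop 0,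
    hsmall (1/8) (by norm_num), hsmall (ε/2) (by linarith)] with n hτ hn h₁ h₂ X i hX
  have hn' : (0 : ℝ) < n := Nat.cast_pos.2 hn
  have hlog : 0 ≤ Real.log n := Real.log_natCast_nonneg n
  refine lt_of_lt_of_le (by norm_num : (1/2 : ℝ) < 5/8)
    (fbShrink_mem_Icc hL hK (b₂ := 1) (inv_pos.2 hn') (hC3.1 n)
      (hC3.2.2.1 n hn) X i fun τ h => ?_).1
  refine ⟨?_, (E1mK_mem_Icc hL.1 hL.2.1 hK.1 (hτ τ h).1 (X i)).2⟩
  have hb₁ : A * Real.exp (-X i ^ 2 / 16) ≤ A * Real.exp (-(1/8 * Real.log n)) := by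
    have : 0 ≤ ε * Real.log n := by positivity
    gcongr
    linarith
  have hb₂ : A * τ⁻¹ * Real.exp (-(1 - 2 * δ) * X i ^ 2 / 2) ≤
      A * Real.exp (-(ε/2 * Real.log n)) := by
    have hτn : τ⁻¹ ≤ n := inv_le_of_inv_le₀ hn' h.1
    have hexp : -(1 - 2 * δ) * X i ^ 2 / 2 ≤ -((1 + ε / 2) * Real.log n) := by
      have := mul_le_mul_of_nonneg_left hX.le hδ'.le
      linear_combination (1/2) * this - Real.log n * hδε
    calc A * τ⁻¹ * Real.exp (-(1 - 2 * δ) * X i ^ 2 / 2)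
        ≤ A * Real.exp (Real.log n) * Real.exp (-((1 + ε / 2) * Real.log n)) := by
          rw [Real.exp_log hn']
          gcongr
      _ = A * Real.exp (-(ε/2 * Real.log n)) := by
          rw [mul_assoc, ← Real.exp_add]
          ring_nf
  linarith [hE τ (X i) (hτ τ h).1 (hτ τ h).2]

lemma tendsto_odds_mul_gaussian_tail (hC3 : CondC3 π2 α) (hp : ∀ n, 0 ≤ p n ∧ p n ≤ 1)
    (hpe : propToR p (-1)) (hcs : Tendsto cs atTop atTop)
    (hcso : Tendsto (fun n : ℕ => cs n / Real.log (Real.log n)) atTop (nhds 0))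
    (hα : ∀ᶠ n : ℕ in atTop,
      Real.log (1/(α n)) = Real.log n - (1/2) * Real.log (Real.log n) + cs n)
    {B : ℝ} (hB : 0 < B) :
    Tendsto (fun n : ℕ => (1 - p n) / p n * (gaussianReal 0 1).real
      {z | 2 * (Real.log (1 / α n) - Real.log (2 * B)) < z ^ 2}) atTop (nhds 0) := by
  obtain ⟨k₁, k₂, h₁, h₂, hk⟩ := hpe.eventually_pos
  have hbound : Tendsto (fun n => k₁⁻¹ * (2 * B) * Real.exp (-cs n)) atTop (nhds 0) := by
    simpa using (Real.tendsto_exp_neg_atTop_nhds_zero.comp hcs).const_mul (k₁⁻¹ * (2 * B))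
  have hratio := tendsto_log_one_div_div_log hcso hα (Real.log (2 * B))
  refine squeeze_zero' ?_ ?_ hbound
  · filter_upwards with n
    have := hp n
    exact mul_nonneg (div_nonneg (by linarith) this.1) measureReal_nonneg
  · filter_upwards [hk, hα, hC3.eventually_pos, tendsto_log_natCast.eventually_gt_atTop 0,
      hratio.eventually_const_lt (show (1/2 : ℝ) < 1 by norm_num), eventually_gt_atTop 0]
      with n hkn hαn hα0 hlog hr hn
    have hn' : (0 : ℝ) < n := Nat.cast_pos.2 hn
    rw [lt_div_iff₀ hlog] at hr
    set s := 2 * (Real.log (1 / α n) - Real.log (2 * B)) with hs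
    have hls : Real.log n ≤ s := by linarith
    have hodds : (1 - p n) / p n ≤ k₁⁻¹ * n := by
      rw [div_le_iff₀ hkn.1, mul_assoc, mul_comm (n : ℝ), ← div_eq_inv_mul, le_div_iff₀ h₁]
      nlinarith [hkn.2.1, hkn.1]
    have hexp : n * Real.exp (-s / 2) = 2 * B * (√(Real.log n) * Real.exp (-cs n)) := by
      rw [show -s / 2 = Real.log (2 * B) + (1 / 2 * Real.log (Real.log n) + -cs n) - Real.log n by
          linarith, Real.exp_sub, Real.exp_add, Real.exp_add, Real.exp_log hn',
        Real.exp_log (by positivity), Real.sqrt_eq_rpow, Real.rpow_def_of_pos hlog]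
      field_simp
    calc (1 - p n) / p n * (gaussianReal 0 1).real {z | s < z ^ 2}
        ≤ k₁⁻¹ * n * (Real.exp (-s / 2) / √s) := by
          gcongr
          exact gaussianReal_lt_sq_le (hlog.trans_le hls)
      _ = k₁⁻¹ * (2 * B) * Real.exp (-cs n) * (√(Real.log n) / √s) := by
          linear_combination k₁⁻¹ / √s * hexp
      _ ≤ k₁⁻¹ * (2 * B) * Real.exp (-cs n) :=
          mul_le_of_le_one_right (by positivity)
            (div_le_one_of_le₀ (Real.sqrt_le_sqrt hls) (Real.sqrt_nonneg s))

lemma tendsto_RBO_div (hp : ∀ n, 0 ≤ p n ∧ p n ≤ 1) (hu : ∀ n, 0 < u n) (hA : Assump2 p u C)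
    (hpos : ∀ᶠ n in atTop, 0 < p n) :
    Tendsto (fun n : ℕ => RBO p u n / (n * p n)) atTop (nhds (gaussSqCdf C)) := by
  have hcdf : Tendsto (fun n => t2BO p u n) atTop (nhds (gaussSqCdf C)) := by
    refine ((continuous_gaussSqCdf.tendsto C).comp (hA.tendsto_csq_div hpos)).congr fun n => ?_
    exact (gaussianReal_zero_sq_le (by linarith [hu n]) _).symm
  have hodds := hA.tendsto_log_odds_div hpos
  have htail : Tendsto (fun n => (1 - p n) / p n * t1BO p u n) atTop (nhds 0) := by
    have hlog : Tendsto (fun n => Real.log (1 + u n)) atTop atTop :=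
      Real.tendsto_log_atTop.comp (tendsto_const_nhds.add_atTop hA.2.1)
    have hbound := Real.tendsto_exp_neg_atTop_nhds_zero.comp
      (hlog.const_mul_atTop (show (0 : ℝ) < 1/2 by norm_num))
    refine squeeze_zero' ?_ ?_ hbound
    · filter_upwards with n
      have := hp n
      exact mul_nonneg (div_nonneg (by linarith) this.1) ENNReal.toReal_nonneg
    · filter_upwards [hpos, hA.1.eventually_lt_const one_pos, hlog.eventually_ge_atTop 1,
        hodds.eventually_const_lt hA.2.2.1] with n h0 h1 h2 h3
      have hun := hu n
      have hf : 0 < (1 - p n) / p n := div_pos (by linarith) h0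
      have hlf : 0 < Real.log ((1 - p n) / p n) := by
        have := (div_pos_iff_of_pos_right hun).1 h3
        linarith
      set ℓ := Real.log (1 + u n) + 2 * Real.log ((1 - p n) / p n) with hℓ
      have hcsq : ℓ ≤ csq p u n :=
        le_mul_of_one_le_left (by linarith) ((one_le_div hun).2 (by linarith))
      have hc1 : 1 ≤ csq p u n := by linarith
      calc (1 - p n) / p n * t1BO p u n
          ≤ (1 - p n) / p n * (Real.exp (-csq p u n / 2) / √(csq p u n)) := by
            gcongr
            exact gaussianReal_lt_sq_le (one_pos.trans_le hc1)
        _ ≤ (1 - p n) / p n * Real.exp (-ℓ / 2) := by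
            gcongr
            refine (div_le_self (Real.exp_pos _).le (Real.one_le_sqrt.2 hc1)).trans ?_
            gcongr
        _ = Real.exp (-(1/2 * Real.log (1 + u n))) := by
            nth_rewrite 1 [← Real.exp_log hf]
            rw [← Real.exp_add, hℓ]
            ring_nf
  have h := htail.add hcdf
  rw [zero_add] at h
  refine h.congr' ?_
  filter_upwards [hpos, eventually_gt_atTop 0] with n h0 hn
  have hn' : (0 : ℝ) < n := Nat.cast_pos.2 hn
  unfold RBO
  field_simp

lemma tendsto_RFB_div (hL : AssumpL L Mb c0 t0) (hK : Kcond (1/2) L K)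
    (hC3 : CondC3 π2 α) (hp : ∀ n, 0 ≤ p n ∧ p n ≤ 1) (hu : ∀ n, 0 < u n)
    (hA : Assump2 p u C) (hpe : propToR p (-1)) (hcs : Tendsto cs atTop atTop)
    (hcso : Tendsto (fun n : ℕ => cs n / Real.log (Real.log n)) atTop (nhds 0))
    (hα : ∀ᶠ n : ℕ in atTop,
      Real.log (1/(α n)) = Real.log n - (1/2) * Real.log (Real.log n) + cs n) :
    Tendsto (fun n : ℕ => RFB (1/2) K L π2 α p u n / (n * p n)) atTop (nhds (gaussSqCdf C)) := by
  obtain ⟨B, hB, hle⟩ := exists_fbShrink_le_half hL hK hC3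
  obtain ⟨k₁, k₂, h₁, h₂, hk⟩ := hpe.eventually_pos
  have hpos : ∀ᶠ n in atTop, 0 < p n := hk.mono fun n h => h.1
  have hlogdiv := hA.tendsto_log_div hpe
  have htail := tendsto_odds_mul_gaussian_tail hC3 hp hpe hcs hcso hα hB
  set s : ℕ → ℝ := fun n => 2 * (Real.log (1 / α n) - Real.log (2 * B)) with hs
  have hsdiv : Tendsto (fun n => s n / (1 + u n)) atTop (nhds C) := by
    have h := (tendsto_log_one_div_div_log hcso hα (Real.log (2 * B))).mul hlogdiv
    rw [one_mul] at h
    refine h.congr' ?_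
    filter_upwards [tendsto_log_natCast.eventually_gt_atTop 0] with n hn
    rw [hs]
    field_simp
  have hlower := (continuous_gaussSqCdf.tendsto C).comp hsdiv
  refine tendsto_order.2 ⟨fun b hb => ?_, fun b hb => ?_⟩
  · filter_upwards [hlower.eventually_const_lt hb, hle, hpos, eventually_gt_atTop 0]
      with n hbn hn h0 hn0
    have hn' : (0 : ℝ) < n := Nat.cast_pos.2 hn0
    refine lt_of_lt_of_le hbn ?_
    rw [le_div_iff₀ (by positivity)]
    calc gaussSqCdf (s n / (1 + u n)) * (n * p n)
        = ∑ _i : Fin n, p n * gaussSqCdf (s n / (1 + u n)) := by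
          rw [Finset.sum_const, Finset.card_univ, Fintype.card_fin, nsmul_eq_mul]
          ring
      _ ≤ RFB (1/2) K L π2 α p u n := by
          refine Finset.sum_le_sum fun i _ => ?_
          have h1 := mul_nonneg (sub_nonneg.2 (hp n).2)
            (ENNReal.toReal_nonneg : 0 ≤ t1FB (1/2) K L π2 α p u n i)
          exact (mul_le_mul_of_nonneg_left (le_t2FB (hp n) (hu n) fun X => hn X i) h0.le).trans
            (le_add_of_nonneg_left h1)
  · obtain ⟨ε, hε, hε', hεb⟩ : ∃ ε : ℝ, 0 < ε ∧ ε ≤ 1/2 ∧ gaussSqCdf ((1 + ε) * C) < b := by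
      have hcont : Tendsto (fun ε : ℝ => gaussSqCdf ((1 + ε) * C)) (nhdsWithin 0 (Ioi 0))
          (nhds (gaussSqCdf C)) := by
        have : Continuous fun ε : ℝ => gaussSqCdf ((1 + ε) * C) :=
          continuous_gaussSqCdf.comp (by fun_prop)
        have h := this.tendsto 0
        rw [add_zero, one_mul] at h
        exact h.mono_left nhdsWithin_le_nhds
      obtain ⟨ε, h, h0⟩ := ((hcont.eventually_lt_const hb).and
        (Ioo_mem_nhdsGT (show (0 : ℝ) < 1/2 by norm_num))).exists
      exact ⟨ε, h0.1, h0.2.le, h⟩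
    have hupper : Tendsto (fun n => (1 - p n) / p n * (gaussianReal 0 1).real {z | s n < z ^ 2} +
        gaussSqCdf (2 * (1 + ε) * Real.log n / (1 + u n))) atTop
        (nhds (gaussSqCdf ((1 + ε) * C))) := by
      have h := htail.add ((continuous_gaussSqCdf.tendsto _).comp (hlogdiv.const_mul (1 + ε)))
      rw [zero_add] at h
      refine h.congr fun n => ?_
      simp only [Function.comp_apply, hs]
      congr 2
      ring
    filter_upwards [hupper.eventually_lt_const hεb, hle,
      eventually_half_lt_fbShrink hL hK hC3 hε hε', hpos, eventually_gt_atTop 0]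
      with n hbn hn hn₂ h0 hn0
    have hn' : (0 : ℝ) < n := Nat.cast_pos.2 hn0
    refine lt_of_le_of_lt ?_ hbn
    rw [div_le_iff₀ (by positivity)]
    set q := (gaussianReal 0 1).real {z | s n < z ^ 2}
    set g := gaussSqCdf (2 * (1 + ε) * Real.log n / (1 + u n))
    calc RFB (1/2) K L π2 α p u n ≤ ∑ _i : Fin n, ((1 - p n) * q + p n * g) := by
          refine Finset.sum_le_sum fun i _ => ?_
          exact add_le_add
            (mul_le_mul_of_nonneg_left (t1FB_le (hp n) fun X => hn X i) (sub_nonneg.2 (hp n).2))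
            (mul_le_mul_of_nonneg_left (t2FB_le (hp n) (hu n) fun X => hn₂ X i) h0.le)
      _ = ((1 - p n) / p n * q + g) * (n * p n) := by
          rw [Finset.sum_const, Finset.card_univ, Fintype.card_fin, nsmul_eq_mul]
          field_simp

end Risk

end PaperGL

open PaperGL MeasureTheory ProbabilityTheory Real Filter Set in
/-- Theorem 8, second part: in the extremely sparse case `p ∝ n⁻¹` with
`a = 1/2`, the full Bayes rule is asymptotically Bayes optimal under sparsity (ABOS). -/
theorem stmt13 (a : ℝ) (ha : a = 1/2) (L : ℝ → ℝ) (Mb c0 t0 K : ℝ)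
    (hL : AssumpL L Mb c0 t0) (hK : Kcond a L K)
    (π2 : ℕ → ℝ → ℝ) (α : ℕ → ℝ) (hC3 : CondC3 π2 α)
    (p u : ℕ → ℝ) (hp : ∀ n, 0 ≤ p n ∧ p n ≤ 1) (hu : ∀ n, 0 < u n)
    (C : ℝ) (hA2 : Assump2 p u C) (hpe : propToR p (-1))
    (cs : ℕ → ℝ) (hcs : Tendsto cs atTop atTop)
    (hcso : Tendsto (fun n : ℕ => cs n / Real.log (Real.log n)) atTop (nhds 0))
    (hα : ∀ᶠ n : ℕ in atTop,
      Real.log (1/(α n)) = Real.log n - (1/2) * Real.log (Real.log n) + cs n) :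
    Tendsto (fun n : ℕ => RFB a K L π2 α p u n / RBO p u n) atTop (nhds 1) := by
  subst ha
  obtain ⟨k₁, k₂, h₁, h₂, hk⟩ := hpe.eventually_pos
  have hpos : ∀ᶠ n in atTop, 0 < p n := hk.mono fun n h => h.1
  have hG : 0 < gaussSqCdf C := gaussSqCdf_pos hA2.2.2.1
  have h := (tendsto_RFB_div hL hK hC3 hp hu hA2 hpe hcs hcso hα).div
    (tendsto_RBO_div hp hu hA2 hpos) hG.ne'
  rw [div_self hG.ne'] at h
  refine h.congr' ?_
  filter_upwards [hpos, eventually_gt_atTop 0] with n h0 hn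
  exact div_div_div_cancel_right₀ (mul_ne_zero (Nat.cast_ne_zero.2 hn.ne') h0.ne') _ _
end
end

section
/- Let L : (0,∞) → (0,∞) be measurable with sup_{t>0} L(t) ≤ M < ∞, let c1 > 0 and γ > 0 be constants, and let q_n ∝ n^β for some 0 < β < 1; set s_n = γ q_n / n. Then there exists a constant C > 0 such that for all sufficiently large n, ∫_1^∞ t^{−1} L(t) s_n² ( ∫_0^{√(c1 log n / (1 + t s_n²))} y² e^{−y²/2} dy ) dt ≤ C (q_n/n) √(log n). -/
open MeasureTheory ProbabilityTheory Real Filter Set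

noncomputable section

lemma sq_mul_exp_neg_half_sq_le (y : ℝ) : y ^ 2 * Real.exp (-y ^ 2 / 2) ≤ 2 := by
  have h := Real.add_one_le_exp (y ^ 2 / 2)
  have hmul : Real.exp (y ^ 2 / 2) * Real.exp (-y ^ 2 / 2) = 1 := by
    rw [← Real.exp_add, neg_div, add_neg_cancel, Real.exp_zero]
  have hpos := Real.exp_pos (-y ^ 2 / 2)
  nlinarith [mul_le_mul_of_nonneg_right h hpos.le]

lemma truncated_second_moment_nonneg (R : ℝ) :
    0 ≤ ∫ y in Set.Ioc (0 : ℝ) R, y ^ 2 * Real.exp (-y ^ 2 / 2) :=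
  MeasureTheory.integral_nonneg fun _ => by positivity

lemma truncated_second_moment_le {R : ℝ} (hR : 0 ≤ R) :
    ∫ y in Set.Ioc (0 : ℝ) R, y ^ 2 * Real.exp (-y ^ 2 / 2) ≤ 2 * R := by
  calc ∫ y in Set.Ioc (0 : ℝ) R, y ^ 2 * Real.exp (-y ^ 2 / 2)
      ≤ ∫ _ in Set.Ioc (0 : ℝ) R, (2 : ℝ) := by
        refine MeasureTheory.integral_mono_of_nonneg
          (Filter.Eventually.of_forall fun _ => by positivity) (by simp)
          (Filter.Eventually.of_forall sq_mul_exp_neg_half_sq_le)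
    _ = 2 * R := by simp [hR, mul_comm]

lemma sqrt_div_one_add_mul_sq_le {A s t : ℝ} (hA : 0 ≤ A) (hs : 0 < s) (ht : 0 < t) :
    √(A / (1 + t * s ^ 2)) ≤ √A / (√t * s) := by
  have hts : √t * s = √(t * s ^ 2) := by
    rw [Real.sqrt_mul ht.le, Real.sqrt_sq hs.le]
  rw [hts, ← Real.sqrt_div hA]
  apply Real.sqrt_le_sqrt
  gcongr
  linarith

lemma integral_inv_mul_truncated_second_moment_le {L : ℝ → ℝ} {M A s : ℝ}
    (hLpos : ∀ t : ℝ, 0 < t → 0 < L t) (hL : ∀ t : ℝ, 0 < t → L t ≤ M)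
    (hA : 0 ≤ A) (hs : 0 ≤ s) :
    (∫ t in Set.Ioi (1 : ℝ), t⁻¹ * L t * s ^ 2 *
        ∫ y in Set.Ioc (0 : ℝ) (√(A / (1 + t * s ^ 2))), y ^ 2 * Real.exp (-y ^ 2 / 2))
      ≤ 4 * M * s * √A := by
  rcases hs.eq_or_lt with rfl | hs
  · simp
  have hint : MeasureTheory.IntegrableOn (fun t : ℝ => t ^ (-3 / 2 : ℝ)) (Set.Ioi 1) :=
    integrableOn_Ioi_rpow_of_lt (by norm_num) one_pos
  have hval : ∫ t in Set.Ioi (1 : ℝ), t ^ (-3 / 2 : ℝ) = 2 := by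
    rw [integral_Ioi_rpow_of_lt (by norm_num) one_pos, Real.one_rpow]
    norm_num
  calc _ ≤ ∫ t in Set.Ioi (1 : ℝ), 2 * M * s * √A * t ^ (-3 / 2 : ℝ) := by
        refine MeasureTheory.integral_mono_of_nonneg ?_ (hint.const_mul _) ?_
        · filter_upwards [MeasureTheory.ae_restrict_mem measurableSet_Ioi] with t ht
          have ht0 : 0 < t := one_pos.trans ht
          have := hLpos t ht0
          have := truncated_second_moment_nonneg (√(A / (1 + t * s ^ 2)))
          simp only [Pi.zero_apply]
          positivity
        · filter_upwards [MeasureTheory.ae_restrict_mem measurableSet_Ioi] with t ht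
          have ht0 : 0 < t := one_pos.trans ht
          have hL0 := hLpos t ht0
          have hM := hL t ht0
          have hM0 : 0 ≤ M := hL0.le.trans hM
          have hpow : t ^ (-3 / 2 : ℝ) = t⁻¹ * (√t)⁻¹ := by
            rw [Real.sqrt_eq_rpow, ← Real.rpow_neg_one, ← Real.rpow_neg ht0.le,
              ← Real.rpow_add ht0]
            norm_num
          calc _ ≤ t⁻¹ * M * s ^ 2 * (2 * (√A / (√t * s))) := by
                refine mul_le_mul (by gcongr) ?_ (truncated_second_moment_nonneg _)
                  (by positivity)
                exact (truncated_second_moment_le (Real.sqrt_nonneg _)).trans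
                  (mul_le_mul_of_nonneg_left (sqrt_div_one_add_mul_sq_le hA hs ht0) zero_le_two)
            _ = 2 * M * s * √A * t ^ (-3 / 2 : ℝ) := by
                have : √t ≠ 0 := (Real.sqrt_pos.2 ht0).ne'
                rw [hpow]
                field_simp
    _ = 4 * M * s * √A := by
        rw [MeasureTheory.integral_const_mul, hval]
        ring

open PaperGL MeasureTheory ProbabilityTheory Real Filter Set in
/-- the key integral estimate for the case `a = 1`. -/
theorem stmt14 (L : ℝ → ℝ) (Mb : ℝ) (hLmeas : Measurable L)
    (hLpos : ∀ t : ℝ, 0 < t → 0 < L t) (hA2 : ∀ t : ℝ, 0 < t → L t ≤ Mb)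
    (c1 γ β : ℝ) (hc1 : 0 < c1) (hγ : 0 < γ) (hβ : 0 < β ∧ β < 1)
    (q : ℕ → ℕ) (hq : propTo q β) :
    ∃ C : ℝ, 0 < C ∧ ∀ᶠ n : ℕ in atTop,
      (∫ t in Set.Ioi (1:ℝ), t⁻¹ * L t * (γ * (q n : ℝ) / (n:ℝ))^2 *
          (∫ y in Set.Ioc (0:ℝ)
              (Real.sqrt (c1 * Real.log n / (1 + t * (γ * (q n : ℝ) / (n:ℝ))^2))),
            y^2 * Real.exp (-y^2/2)))
        ≤ C * ((q n : ℝ)/(n:ℝ)) * Real.sqrt (Real.log n) := by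
  have hM : 0 < Mb := (hLpos 1 one_pos).trans_le (hA2 1 one_pos)
  have hsc := Real.sqrt_pos.2 hc1
  refine ⟨4 * Mb * γ * √c1, by positivity, Eventually.of_forall fun n => ?_⟩
  have hlog : 0 ≤ Real.log n := Real.log_natCast_nonneg n
  refine (integral_inv_mul_truncated_second_moment_le hLpos hA2 (mul_nonneg hc1.le hlog)
    (by positivity)).trans_eq ?_
  rw [Real.sqrt_mul hc1.le]
  ring
end
end

section
/- For every a > 0, every τ > 0 and every x ∈ ℝ, the posterior variance satisfies Var(θ|x,τ) ≤ E(1−κ|x,τ)·1{|x| ≤ 1} + 2x²·E(1−κ|x,τ). -/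
open MeasureTheory ProbabilityTheory Real Filter Set

noncomputable section

namespace PaperGL

theorem kdens_nonneg {a : ℝ} {L : ℝ → ℝ} (hLpos : ∀ t : ℝ, 0 < t → 0 < L t) {τ : ℝ} (hτ : 0 < τ)
    (x : ℝ) {κ : ℝ} (hκ : κ ∈ Set.Ioo (0 : ℝ) 1) : 0 ≤ kdens a L x τ κ := by
  have hκ0 : 0 < κ := hκ.1
  have h1 : 0 < 1 - κ := sub_pos.2 hκ.2
  have h2 : 0 < 1 / κ - 1 := sub_pos.2 ((one_lt_div hκ0).2 hκ.2)
  have hL := hLpos (1 / τ ^ 2 * (1 / κ - 1)) (by positivity)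
  unfold kdens
  positivity

/-- If the posterior kernel is not integrable, all posterior expectations take the value `0`. -/
theorem kExp_eq_zero_of_not_integrableOn {a : ℝ} {L : ℝ → ℝ} {x τ : ℝ}
    (h : ¬ IntegrableOn (kdens a L x τ) (Set.Ioo 0 1)) (g : ℝ → ℝ) : kExp a L x τ g = 0 := by
  rw [kExp, integral_undef (f := fun κ => kdens a L x τ κ) h, div_zero]

theorem kExp_nonneg {a : ℝ} {L : ℝ → ℝ} (hLpos : ∀ t : ℝ, 0 < t → 0 < L t) {τ : ℝ} (hτ : 0 < τ)
    (x : ℝ) {g : ℝ → ℝ} (hg : ∀ κ ∈ Set.Ioo (0 : ℝ) 1, 0 ≤ g κ) : 0 ≤ kExp a L x τ g :=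
  div_nonneg
    (setIntegral_nonneg measurableSet_Ioo fun κ hκ =>
      mul_nonneg (hg κ hκ) (kdens_nonneg hLpos hτ x hκ))
    (setIntegral_nonneg measurableSet_Ioo fun _ hκ => kdens_nonneg hLpos hτ x hκ)

theorem kExp_mono {a : ℝ} {L : ℝ → ℝ} (hLpos : ∀ t : ℝ, 0 < t → 0 < L t) {τ : ℝ} (hτ : 0 < τ)
    (x : ℝ) {f g : ℝ → ℝ} (hf : Continuous f) (hg : Continuous g)
    (hfg : ∀ κ ∈ Set.Ioo (0 : ℝ) 1, f κ ≤ g κ) : kExp a L x τ f ≤ kExp a L x τ g := by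
  by_cases hint : IntegrableOn (kdens a L x τ) (Set.Ioo 0 1)
  · have hmul : ∀ {φ : ℝ → ℝ}, Continuous φ →
        IntegrableOn (fun κ => φ κ * kdens a L x τ κ) (Set.Ioo 0 1) := fun hφ =>
      hint.continuousOn_mul_of_subset hφ.continuousOn isCompact_Icc measurableSet_Ioo
        Set.Ioo_subset_Icc_self
    refine div_le_div_of_nonneg_right
      (setIntegral_mono_on (hmul hf) (hmul hg) measurableSet_Ioo fun κ hκ =>
        mul_le_mul_of_nonneg_right (hfg κ hκ) (kdens_nonneg hLpos hτ x hκ))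
      (setIntegral_nonneg measurableSet_Ioo fun _ hκ => kdens_nonneg hLpos hτ x hκ)
  · simp only [kExp_eq_zero_of_not_integrableOn hint, le_refl]

end PaperGL

open PaperGL MeasureTheory ProbabilityTheory Real Filter Set in
/-- the posterior variance bound `(T-1.16)`. -/
theorem stmt16 (a : ℝ) (ha : 0 < a) (L : ℝ → ℝ) (K : ℝ)
    (hLmeas : Measurable L) (hLpos : ∀ t : ℝ, 0 < t → 0 < L t)
    (hK : Kcond a L K) (τ : ℝ) (hτ : 0 < τ) (x : ℝ) :
    postVar a L x τ ≤
      E1mK a L x τ * (if |x| ≤ 1 then 1 else 0) + 2 * x^2 * E1mK a L x τ := by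
  have hE : 0 ≤ E1mK a L x τ := kExp_nonneg hLpos hτ x fun κ hκ => sub_nonneg.2 hκ.2.le
  have hE2 : kExp a L x τ (fun κ => (1 - κ) ^ 2) ≤ E1mK a L x τ :=
    kExp_mono hLpos hτ x (by fun_prop) (by fun_prop) fun κ hκ => by
      nlinarith [hκ.1, hκ.2]
  have hvar : x ^ 2 * (kExp a L x τ (fun κ => (1 - κ) ^ 2) - E1mK a L x τ ^ 2) ≤
      x ^ 2 * E1mK a L x τ :=
    mul_le_mul_of_nonneg_left (by nlinarith) (sq_nonneg x)
  have hxE : 0 ≤ x ^ 2 * E1mK a L x τ := by positivity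
  unfold postVar
  split_ifs with hx
  · linarith
  · have hx2 : 1 ≤ x ^ 2 := (one_le_sq_iff_one_le_abs x).2 (not_le.1 hx).le
    have := mul_le_mul_of_nonneg_right hx2 hE
    linarith
end
end

section
/- Let a > 0, ρ > 0, ε ∈ (0,1] and C ∈ (0,∞). Suppose (p_n) is a sequence with p_n → 0 and p_n ∝ n^{−ε}, and (ψ_n²) is a sequence with ψ_n² → ∞ such that log(ψ_n² f_n²)/ψ_n² → C, where f_n = (1−p_n)/p_n. If Z_n ~ N(0, 1 + ψ_n²), then lim_{n→∞} P( |Z_n| ≤ √(2aρ log n) ) = 2Φ(√(aρC/ε)) − 1, where Φ is the standard normal cdf. -/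
open MeasureTheory ProbabilityTheory Real Filter Set

noncomputable section

theorem continuous_cdf_of_nullSingletonClass (μ : Measure ℝ) [IsProbabilityMeasure μ]
    [NullSingletonClass μ] : Continuous (cdf μ) := by
  rw [continuous_iff_continuousAt]
  intro x
  rw [(monotone_cdf μ).continuousAt_iff_leftLim_eq_rightLim, StieltjesFunction.rightLim_eq]
  refine le_antisymm ((monotone_cdf μ).leftLim_le le_rfl) ?_
  have h := (cdf μ).measure_singleton x
  rw [measure_cdf, measure_singleton, eq_comm, ENNReal.ofReal_eq_zero] at h
  linarith

namespace PaperGL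

theorem Phi_eq_cdf : Phi = cdf (gaussianReal 0 1) :=
  funext fun x => (cdf_eq_real (gaussianReal 0 1) x).symm

theorem continuous_Phi : Continuous Phi := by
  have := nullSingletonClass_gaussianReal (μ := 0) one_ne_zero
  rw [Phi_eq_cdf]
  exact continuous_cdf_of_nullSingletonClass _

theorem Phi_neg (t : ℝ) : Phi (-t) = 1 - Phi t := by
  have := nullSingletonClass_gaussianReal (μ := 0) one_ne_zero
  have h1 : Phi (-t) = (gaussianReal 0 1).real (Ici t) := by
    conv_lhs => rw [Phi, ← neg_zero, ← gaussianReal_map_neg, Measure.map_apply (by fun_prop)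
      measurableSet_Iic]
    simp [Measure.real]
  have h2 := probReal_compl_eq_one_sub (μ := gaussianReal 0 1) (measurableSet_Iic (a := t))
  rw [h1, measureReal_congr Ioi_ae_eq_Ici.symm, ← compl_Iic, h2]
  rfl

/-- The standard normal probability of `[-t, t]`. -/
theorem gaussianReal_abs_le {t : ℝ} (ht : 0 ≤ t) :
    (gaussianReal 0 1).real {x : ℝ | |x| ≤ t} = 2 * Phi t - 1 := by
  have := nullSingletonClass_gaussianReal (μ := 0) one_ne_zero
  have hset : {x : ℝ | |x| ≤ t} = Icc (-t) t := by
    ext x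
    simp [abs_le]
  have hdiff := measureReal_sdiff (μ := gaussianReal 0 1)
    (Iic_subset_Iic.2 (neg_le_self ht)) measurableSet_Iic
  rw [hset, measureReal_congr Ioc_ae_eq_Icc.symm, ← Iic_sdiff_Iic, hdiff]
  change Phi t - Phi (-t) = _
  rw [Phi_neg]
  ring

theorem gaussianReal_abs_le_sqrt {w s : ℝ} (hw : 0 < w) :
    (gaussianReal 0 w.toNNReal).real {z : ℝ | |z| ≤ √s} = 2 * Phi √(s / w) - 1 := by
  have hmap : gaussianReal 0 w.toNNReal = (gaussianReal 0 1).map (√w * ·) := by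
    rw [gaussianReal_map_const_mul, mul_zero]
    congr 1
    ext
    simp [hw.le]
  have hset : (√w * ·) ⁻¹' {z : ℝ | |z| ≤ √s} = {x : ℝ | |x| ≤ √(s / w)} := by
    ext x
    simp [abs_mul, abs_of_nonneg, Real.sqrt_div' _ hw.le, le_div_iff₀ (Real.sqrt_pos.2 hw),
      mul_comm]
  rw [hmap, map_measureReal_apply (by fun_prop) (measurableSet_le (by fun_prop) (by fun_prop)),
    hset, gaussianReal_abs_le (Real.sqrt_nonneg _)]

theorem propToR.eventually_pos_s19 {p : ℕ → ℝ} {β : ℝ} (hp : propToR p β) :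
    ∀ᶠ n in atTop, 0 < p n := by
  obtain ⟨k1, k2, hk1, hk2, h⟩ := hp
  filter_upwards [h, eventually_gt_atTop 0] with n hn hn0
  have : (0 : ℝ) < n := by exact_mod_cast hn0
  exact (by positivity : 0 < k1 * (n : ℝ) ^ β).trans_le hn.1

theorem propToR.tendsto_log_sub_div {p u : ℕ → ℝ} {β : ℝ} (hp : propToR p β)
    (hu : Tendsto u atTop atTop) :
    Tendsto (fun n : ℕ => (Real.log (p n) - β * Real.log n) / u n) atTop (nhds 0) := by
  have hpos := hp.eventually_pos_s19
  obtain ⟨k1, k2, hk1, hk2, h⟩ := hp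
  refine tendsto_of_tendsto_of_tendsto_of_le_of_le'
    (hu.const_div_atTop (Real.log k1)) (hu.const_div_atTop (Real.log k2)) ?_ ?_
  all_goals
    filter_upwards [h, hpos, eventually_gt_atTop 0, hu.eventually_gt_atTop 0]
      with n hn hpn hn0 hun
    have hn0 : (0 : ℝ) < n := by exact_mod_cast hn0
    have hpow : 0 < (n : ℝ) ^ β := Real.rpow_pos_of_pos hn0 β
    gcongr
  · have := Real.log_le_log (by positivity) hn.1
    rw [Real.log_mul hk1.ne' hpow.ne', Real.log_rpow hn0] at this
    linarith
  · have := Real.log_le_log hpn hn.2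
    rw [Real.log_mul hk2.ne' hpow.ne', Real.log_rpow hn0] at this
    linarith

theorem tendsto_log_div_of_log_odds {p u : ℕ → ℝ} {e C : ℝ} (he : 0 < e)
    (hp0 : Tendsto p atTop (nhds 0)) (hpe : propToR p (-e)) (hu : Tendsto u atTop atTop)
    (hlim : Tendsto (fun n : ℕ => Real.log (u n * ((1 - p n)/p n)^2) / u n) atTop (nhds C)) :
    Tendsto (fun n : ℕ => Real.log n / (1 + u n)) atTop (nhds (C / (2 * e))) := by
  have hlogu : Tendsto (fun n => Real.log (u n) / u n) atTop (nhds 0) :=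
    Real.isLittleO_log_id_atTop.tendsto_div_nhds_zero.comp hu
  have hlogq : Tendsto (fun n => Real.log (1 - p n) / u n) atTop (nhds 0) := by
    refine Tendsto.div_atTop (a := Real.log (1 - 0)) ?_ hu
    exact (tendsto_const_nhds.sub hp0).log (by norm_num)
  have hratio : Tendsto (fun n => u n / (1 + u n)) atTop (nhds 1) := by
    have h : Tendsto (fun n => 1 - 1 / (1 + u n)) atTop (nhds (1 - 0)) :=
      tendsto_const_nhds.sub ((tendsto_atTop_add_const_left _ 1 hu).const_div_atTop 1)
    rw [sub_zero] at h
    refine h.congr' ?_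
    filter_upwards [hu.eventually_gt_atTop 0] with n hn
    field_simp
    ring
  have key := ((((hlim.sub hlogu).sub (hlogq.const_mul 2)).add
    ((hpe.tendsto_log_sub_div hu).const_mul 2)).mul hratio).const_mul (1 / (2 * e))
  have hval : 1 / (2 * e) * ((C - 0 - 2 * 0 + 2 * 0) * 1) = C / (2 * e) := by ring
  rw [hval] at key
  refine key.congr' ?_
  filter_upwards [hpe.eventually_pos_s19, hp0.eventually_lt_const one_pos, hu.eventually_gt_atTop 0]
    with n hpn hpn1 hun
  have hq : 0 < 1 - p n := by linarith
  rw [Real.log_mul hun.ne' (by positivity), Real.log_pow, Real.log_div hq.ne' hpn.ne']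
  push_cast
  field_simp
  ring

end PaperGL

open PaperGL MeasureTheory ProbabilityTheory Real Filter Set in
/-- limit of the central probability of `N(0, 1+ψₙ²)` under Assumption 2. -/
theorem stmt19 (a ρ e C : ℝ) (ha : 0 < a) (hρ : 0 < ρ) (he : 0 < e ∧ e ≤ 1) (hC : 0 < C)
    (p u : ℕ → ℝ) (hp0 : Tendsto p atTop (nhds 0)) (hpe : propToR p (-e))
    (hu : Tendsto u atTop atTop)
    (hlim : Tendsto (fun n : ℕ => Real.log (u n * ((1 - p n)/p n)^2) / u n) atTop (nhds C)) :
    Tendsto (fun n : ℕ =>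
        ((gaussianReal 0 (Real.toNNReal (1 + u n)))
          {z : ℝ | |z| ≤ Real.sqrt (2*a*ρ*Real.log n)}).toReal)
      atTop (nhds (2 * Phi (Real.sqrt (a*ρ*C/e)) - 1)) := by
  have hT : Tendsto (fun n : ℕ => 2*a*ρ*Real.log n / (1 + u n)) atTop (nhds (a*ρ*C/e)) := by
    have h := (tendsto_log_div_of_log_odds he.1 hp0 hpe hu hlim).const_mul (2*a*ρ)
    have hval : 2*a*ρ*(C / (2 * e)) = a*ρ*C/e := by
      field_simp
    rw [hval] at h
    exact h.congr fun n => by ring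
  have hΦ := (((continuous_Phi.tendsto _).comp hT.sqrt).const_mul 2).sub_const 1
  refine hΦ.congr' ?_
  filter_upwards [hu.eventually_gt_atTop 0] with n hn
  exact (gaussianReal_abs_le_sqrt (by linarith)).symm
end
end
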